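/- Let G be a 2-edge-connected graph and let T ⊆ V(G) be infinite. Then G contains a T-join. -/

import Mathlib

namespace SimpleGraph

variable {V : Type*}

/-- A `T`-join in `G`: a set `P` of (oriented) paths, pairwise edge-disjoint, each with two
distinct endpoints lying in `T`, such that every vertex of `T` is an endpoint of exactly one
path of `P`. -/
def IsTJoin (G : SimpleGraph V) (T : Set V) (P : Set (Σ u : V, Σ v : V, G.Walk u v)) : Prop :=
  (∀ p ∈ P, p.2.2.IsPath ∧ p.1 ≠ p.2.1 ∧ p.1 ∈ T ∧ p.2.1 ∈ T) ∧
  (∀ p ∈ P, ∀ q ∈ P, p ≠ q → ∀ e ∈ p.2.2.edges, e ∉ q.2.2.edges) ∧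
  (∀ t ∈ T, ∃! p, p ∈ P ∧ (p.1 = t ∨ p.2.1 = t))

/-- `G` contains a `T`-join. -/
def HasTJoin (G : SimpleGraph V) (T : Set V) : Prop := ∃ P, G.IsTJoin T P

end SimpleGraph

namespace SimpleGraph

variable {V : Type*}

/-- A graph is 2-edge-connected if it is connected and stays connected after deleting any
single edge. -/
def TwoEdgeConnected (G : SimpleGraph V) : Prop :=
  G.Connected ∧ ∀ e ∈ G.edgeSet, (G.deleteEdges {e}).Connected

end SimpleGraph


namespace TJ
open SimpleGraph
variable {V : Type*} {ι : Type*}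

/-- Reachability using only edges from `A`. -/
def Rch (A : Set (Sym2 V)) (u v : V) : Prop := Relation.ReflTransGen (fun a b => s(a, b) ∈ A) u v

theorem Rch.refl {A : Set (Sym2 V)} (u : V) : Rch A u u := Relation.ReflTransGen.refl
theorem Rch.trans {A : Set (Sym2 V)} {u v w : V} (h : Rch A u v) (h' : Rch A v w) : Rch A u w :=
  Relation.ReflTransGen.trans h h'
theorem Rch.single {A : Set (Sym2 V)} {u v : V} (h : s(u, v) ∈ A) : Rch A u v :=
  Relation.ReflTransGen.single h
theorem Rch.symm {A : Set (Sym2 V)} {u v : V} (h : Rch A u v) : Rch A v u := by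
  induction h with
  | refl => exact Rch.refl _
  | tail _ h ih => exact (Rch.single (by rwa [Sym2.eq_swap])).trans ih
theorem Rch.mono {A B : Set (Sym2 V)} (hAB : A ⊆ B) {u v : V} (h : Rch A u v) : Rch B u v := by
  induction h with
  | refl => exact Rch.refl _
  | tail _ h ih => exact ih.trans (Rch.single (hAB h))

theorem Rch.exists_path {G : SimpleGraph V} {A : Set (Sym2 V)} (hA : A ⊆ G.edgeSet) {u v : V}
    (h : Rch A u v) : ∃ w : G.Walk u v, w.IsPath ∧ ∀ e ∈ w.edges, e ∈ A := by
  classical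
  have : ∃ w : G.Walk u v, ∀ e ∈ w.edges, e ∈ A := by
    induction h using Relation.ReflTransGen.head_induction_on with
    | refl => exact ⟨Walk.nil, by simp⟩
    | head h _ ih =>
      obtain ⟨w, hw⟩ := ih
      have hadj : G.Adj _ _ := hA h
      refine ⟨Walk.cons hadj w, ?_⟩
      intro e he
      rw [Walk.edges_cons, List.mem_cons] at he
      rcases he with rfl | he
      · exact h
      · exact hw e he
  obtain ⟨w, hw⟩ := this
  exact ⟨w.bypass, w.bypass_isPath, fun e he => hw e (w.edges_bypass_subset_edges he)⟩

theorem rch_of_walk {G : SimpleGraph V} {A : Set (Sym2 V)} {u v : V} (w : G.Walk u v)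
    (hw : ∀ e ∈ w.edges, e ∈ A) : Rch A u v := by
  induction w with
  | nil => exact Rch.refl _
  | cons h w ih =>
    simp only [Walk.edges_cons, List.mem_cons, forall_eq_or_imp] at hw
    exact (Rch.single hw.1).trans (ih hw.2)

/-- Tokens `D` at positions `p` can be reduced, using edge-disjoint connections inside `E`, to
tokens `D'` at positions `p'`: tokens outside `D'` are joined in pairs, the others are moved. -/
def Red (E : Set (Sym2 V)) (D : Set ι) (p : ι → V) (D' : Set ι) (p' : ι → V) : Prop :=
  ∃ (σ : ι → ι) (A : ι → Set (Sym2 V)), D' ⊆ D ∧ (∀ i ∈ D, A i ⊆ E) ∧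
    (∀ i ∈ D', σ i = i ∧ Rch (A i) (p i) (p' i)) ∧
    (∀ i ∈ D, i ∉ D' → σ i ∈ D ∧ σ i ∉ D' ∧ σ i ≠ i ∧ σ (σ i) = i ∧ A (σ i) = A i ∧
      Rch (A i) (p i) (p (σ i))) ∧
    (∀ i ∈ D, ∀ j ∈ D, j ≠ i → j ≠ σ i → Disjoint (A i) (A j))

theorem Red.subset {E : Set (Sym2 V)} {D D' : Set ι} {p p' : ι → V} (h : Red E D p D' p') :
    D' ⊆ D := by obtain ⟨_, _, h, _⟩ := h; exact h

theorem Red.mono {E F : Set (Sym2 V)} {D D' : Set ι} {p p' : ι → V} (h : Red E D p D' p')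
    (hEF : E ⊆ F) : Red F D p D' p' := by
  obtain ⟨σ, A, h1, h2, h3, h4, h5⟩ := h
  exact ⟨σ, A, h1, fun i hi => (h2 i hi).trans hEF, h3, h4, h5⟩

theorem Red.congr {E : Set (Sym2 V)} {D D' : Set ι} {p p' q q' : ι → V} (h : Red E D p D' p')
    (hp : ∀ i ∈ D, p i = q i) (hp' : ∀ i ∈ D', p' i = q' i) : Red E D q D' q' := by
  obtain ⟨σ, A, h1, h2, h3, h4, h5⟩ := h
  refine ⟨σ, A, h1, h2, fun i hi => ⟨(h3 i hi).1, ?_⟩, fun i hi hi' => ?_, h5⟩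
  · rw [← hp i (h1 hi), ← hp' i hi]; exact (h3 i hi).2
  · obtain ⟨a, b, c, d, e, f⟩ := h4 i hi hi'
    refine ⟨a, b, c, d, e, ?_⟩
    rw [← hp i hi, ← hp _ a]; exact f

theorem Red.move {E : Set (Sym2 V)} {i : ι} {p p' : ι → V} (h : Rch E (p i) (p' i)) :
    Red E {i} p {i} p' := by
  refine ⟨id, fun _ => E, le_rfl, fun _ _ => le_rfl, ?_, ?_, ?_⟩
  · rintro j rfl; exact ⟨rfl, h⟩
  · rintro j rfl h; exact absurd rfl h
  · rintro j rfl k rfl h; exact absurd rfl h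

theorem Red.pair {E : Set (Sym2 V)} {i j : ι} (hij : i ≠ j) {p p' : ι → V}
    (h : Rch E (p i) (p j)) : Red E {i, j} p ∅ p' := by
  classical
  refine ⟨Equiv.swap i j, fun _ => E, by simp, fun _ _ => le_rfl, by simp, ?_, ?_⟩
  · rintro k (rfl | rfl) -
    · simp [hij.symm, h]
    · simp [hij, h.symm]
  · rintro k (rfl | rfl) l (rfl | rfl) h1 h2 <;> simp_all

theorem Red.id {D : Set ι} {p : ι → V} : Red ∅ D p D p :=
  ⟨fun i => i, fun _ => ∅, le_rfl, fun _ _ => le_rfl, fun _ _ => ⟨rfl, Rch.refl _⟩,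
    fun _ h h' => absurd h h', fun _ _ _ _ _ _ => by simp⟩

theorem glue {κ β : Type*} (D : κ → Set ι) (hD : Pairwise fun k l => Disjoint (D k) (D l))
    (f : κ → ι → β) (d : ι → β) : ∃ F : ι → β, ∀ k, ∀ i ∈ D k, F i = f k i := by
  classical
  refine ⟨fun i => if h : ∃ k, i ∈ D k then f h.choose i else d i, fun k i hi => ?_⟩
  have h : ∃ k, i ∈ D k := ⟨k, hi⟩
  have : h.choose = k := by
    by_contra hne
    exact Set.disjoint_left.1 (hD hne) h.choose_spec hi
  simp only [h, dif_pos, this]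

theorem Red.par {κ : Type*} (E : κ → Set (Sym2 V)) (D D' : κ → Set ι) (p : ι → V)
    (p' : κ → ι → V) (hE : Pairwise fun k l => Disjoint (E k) (E l))
    (hD : Pairwise fun k l => Disjoint (D k) (D l))
    (h : ∀ k, Red (E k) (D k) p (D' k) (p' k)) :
    ∃ q : ι → V, (∀ k, ∀ i ∈ D k, q i = p' k i) ∧ Red (⋃ k, E k) (⋃ k, D k) p (⋃ k, D' k) q := by
  choose σ A h1 h2 h3 h4 h5 using h
  obtain ⟨q, hq⟩ := glue D hD p' p
  obtain ⟨S, hS⟩ := glue D hD σ (fun i => i)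
  obtain ⟨B, hB⟩ := glue D hD A (fun _ => ∅)
  have uniq : ∀ {k l i}, i ∈ D k → i ∈ D l → k = l := fun {k l i} hk hl => by
    by_contra hne
    exact Set.disjoint_left.1 (hD hne) hk hl
  refine ⟨q, hq, S, B, Set.iUnion_mono h1, ?_, ?_, ?_, ?_⟩
  · intro i hi
    obtain ⟨k, hk⟩ := Set.mem_iUnion.1 hi
    rw [hB k i hk]
    exact (h2 k i hk).trans (Set.subset_iUnion _ k)
  · intro i hi
    obtain ⟨k, hk⟩ := Set.mem_iUnion.1 hi
    have hk' := h1 k hk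
    rw [hB k i hk', hq k i hk', hS k i hk']
    exact h3 k i hk
  · intro i hi hi'
    obtain ⟨k, hk⟩ := Set.mem_iUnion.1 hi
    have hk' : i ∉ D' k := fun h => hi' (Set.mem_iUnion.2 ⟨k, h⟩)
    obtain ⟨a, b, c, d, e, f⟩ := h4 k i hk hk'
    rw [hS k i hk, hS k _ a, hB k i hk, hB k _ a]
    refine ⟨Set.mem_iUnion.2 ⟨k, a⟩, ?_, c, d, e, f⟩
    intro hx
    obtain ⟨l, hl⟩ := Set.mem_iUnion.1 hx
    obtain rfl := uniq a (h1 l hl)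
    exact b hl
  · intro i hi j hj hij hij'
    obtain ⟨k, hk⟩ := Set.mem_iUnion.1 hi
    obtain ⟨l, hl⟩ := Set.mem_iUnion.1 hj
    rw [hB k i hk, hB l j hl]
    by_cases hkl : k = l
    · subst hkl
      rw [hS k i hk] at hij'
      exact h5 k i hk j hl hij hij'
    · exact (hE hkl).mono (h2 k i hk) (h2 l j hl)

/-- Parallel composition with common target position. -/
theorem Red.par' {κ : Type*} (E : κ → Set (Sym2 V)) (D D' : κ → Set ι) (p p' : ι → V)
    (hE : Pairwise fun k l => Disjoint (E k) (E l))
    (hD : Pairwise fun k l => Disjoint (D k) (D l))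
    (h : ∀ k, Red (E k) (D k) p (D' k) p') :
    Red (⋃ k, E k) (⋃ k, D k) p (⋃ k, D' k) p' := by
  obtain ⟨q, hq, hr⟩ := Red.par E D D' p (fun _ => p') hE hD h
  refine hr.congr (fun _ _ => rfl) fun i hi => ?_
  obtain ⟨k, hk⟩ := Set.mem_iUnion.1 hi
  exact hq k i ((h k).subset hk)

theorem Red.union {E₁ E₂ : Set (Sym2 V)} {D₁ D₂ D₁' D₂' : Set ι} {p p' : ι → V}
    (hE : Disjoint E₁ E₂) (hD : Disjoint D₁ D₂) (h₁ : Red E₁ D₁ p D₁' p')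
    (h₂ : Red E₂ D₂ p D₂' p') : Red (E₁ ∪ E₂) (D₁ ∪ D₂) p (D₁' ∪ D₂') p' := by
  have := Red.par' (κ := Bool) (fun b => cond b E₁ E₂) (fun b => cond b D₁ D₂)
    (fun b => cond b D₁' D₂') p p' ?_ ?_ ?_
  · have e : ∀ s t : Set ι, (⋃ b : Bool, cond b s t) = s ∪ t := fun s t => by
      ext; simp [or_comm]
    have e' : ∀ s t : Set (Sym2 V), (⋃ b : Bool, cond b s t) = s ∪ t := fun s t => by
      ext; simp [or_comm]
    rwa [e, e, e'] at this
  · rintro (_ | _) (_ | _) h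
    · exact absurd rfl h
    · exact hE.symm
    · exact hE
    · exact absurd rfl h
  · rintro (_ | _) (_ | _) h
    · exact absurd rfl h
    · exact hD.symm
    · exact hD
    · exact absurd rfl h
  · rintro (_ | _)
    · exact h₂
    · exact h₁

theorem Red.comp {E₁ E₂ : Set (Sym2 V)} {D D' D'' : Set ι} {p p' p'' : ι → V}
    (hE : Disjoint E₁ E₂) (h₁ : Red E₁ D p D' p') (h₂ : Red E₂ D' p' D'' p'') :
    Red (E₁ ∪ E₂) D p D'' p'' := by
  classical
  obtain ⟨σ, A, a1, a2, a3, a4, a5⟩ := h₁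
  obtain ⟨τ, B, b1, b2, b3, b4, b5⟩ := h₂
  have htD : ∀ i ∈ D', τ i ∈ D' := fun i hi => by
    by_cases h : i ∈ D''
    · rwa [(b3 i h).1]
    · exact (b4 i hi h).1
  have htt : ∀ i ∈ D', τ (τ i) = i := fun i hi => by
    by_cases h : i ∈ D''
    · rw [(b3 i h).1, (b3 i h).1]
    · exact (b4 i hi h).2.2.2.1
  have hAA : ∀ i ∈ D', ∀ j ∈ D', j ≠ i → Disjoint (A i) (A j) := fun i hi j hj hij =>
    a5 i (a1 hi) j (a1 hj) hij (by rwa [(a3 i hi).1])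
  have hAB : ∀ i ∈ D, ∀ j ∈ D', Disjoint (A i) (B j) := fun i hi j hj =>
    hE.mono (a2 i hi) (b2 j hj)
  refine ⟨fun i => if i ∈ D' then τ i else σ i,
    fun i => if i ∈ D' then A i ∪ B i ∪ A (τ i) else A i, b1.trans a1, ?_, ?_, ?_, ?_⟩
  · intro i hi
    dsimp only
    split_ifs with h
    · refine Set.union_subset (Set.union_subset ?_ ?_) ?_
      · exact (a2 i hi).trans Set.subset_union_left
      · exact (b2 i h).trans Set.subset_union_right
      · exact (a2 _ (a1 (htD i h))).trans Set.subset_union_left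
    · exact (a2 i hi).trans Set.subset_union_left
  · intro i hi
    have h := b1 hi
    simp only [h, if_true]
    refine ⟨(b3 i hi).1, ((a3 i h).2.mono ?_).trans ((b3 i hi).2.mono ?_)⟩
    · intro x hx; exact Or.inl (Or.inl hx)
    · intro x hx; exact Or.inl (Or.inr hx)
  · intro i hi hi'
    by_cases h : i ∈ D'
    · obtain ⟨x1, x2, x3, x4, x5, x6⟩ := b4 i h hi'
      simp only [h, if_true, x1, x4, x5]
      refine ⟨a1 x1, x2, x3, trivial, ?_, ?_⟩
      · ext x; simp only [Set.mem_union]; tauto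
      · refine (((a3 i h).2.mono ?_).trans (x6.mono ?_)).trans ((a3 _ x1).2.symm.mono ?_)
        · intro x hx; exact Or.inl (Or.inl hx)
        · intro x hx; exact Or.inl (Or.inr hx)
        · intro x hx; exact Or.inr hx
    · obtain ⟨x1, x2, x3, x4, x5, x6⟩ := a4 i hi h
      simp only [h, if_false, x2]
      exact ⟨x1, fun hh => x2 (b1 hh), x3, x4, x5, x6⟩
  · intro i hi j hj hij hij'
    by_cases h : i ∈ D' <;> by_cases h' : j ∈ D' <;>
      simp only [h, h', if_true, if_false] at hij' ⊢
    · have hti := htD i h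
      have htj := htD j h'
      have hji : τ j ≠ i := fun e => hij' (by rw [← e, htt j h'])
      have hji' : τ j ≠ τ i := fun e => hij (by rw [← htt i h, ← e, htt j h'])
      simp only [Set.disjoint_union_left, Set.disjoint_union_right]
      refine ⟨⟨⟨⟨?_, ?_⟩, ?_⟩, ⟨⟨?_, ?_⟩, ?_⟩⟩, ⟨⟨?_, ?_⟩, ?_⟩⟩
      · exact hAA _ h _ h' hij
      · exact (hAB _ (a1 h') _ h).symm
      · exact hAA _ hti _ h' hij'
      · exact hAB _ (a1 h) _ h'
      · exact b5 _ h _ h' hij hij'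
      · exact hAB _ (a1 hti) _ h'
      · exact hAA _ h _ htj hji
      · exact (hAB _ (a1 htj) _ h).symm
      · exact hAA _ hti _ htj hji'
    · simp only [Set.disjoint_union_left]
      have hn : ∀ k ∈ D', Disjoint (A k) (A j) := fun k hk => by
        refine a5 k (a1 hk) j hj ?_ ?_
        · rintro rfl; exact h' hk
        · rw [(a3 k hk).1]; rintro rfl; exact h' hk
      exact ⟨⟨hn i h, (hAB j hj i h).symm⟩, hn _ (htD i h)⟩
    · simp only [Set.disjoint_union_right]
      have hn : ∀ k ∈ D', Disjoint (A i) (A k) := fun k hk => by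
        refine (a5 k (a1 hk) i hi ?_ ?_).symm
        · rintro rfl; exact h hk
        · rw [(a3 k hk).1]; rintro rfl; exact h hk
      exact ⟨⟨hn j h', hAB i hi j h'⟩, hn _ (htD j h')⟩
    · exact a5 i hi j hj hij hij'

/-! ### Pairing tokens at one vertex -/

theorem pairing_inf {D : Set ι} (hD : D.Infinite) {p p' : ι → V}
    (hp : ∀ i ∈ D, ∀ j ∈ D, p i = p j) : Red ∅ D p ∅ p' := by
  have : Infinite D := hD.to_subtype
  have hc : Cardinal.mk (D × Bool) = Cardinal.mk D := by
    simp only [Cardinal.mk_prod, Cardinal.mk_bool, Cardinal.lift_uzero]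
    simp only [Cardinal.lift_ofNat]
    exact Cardinal.mul_eq_left (Cardinal.aleph0_le_mk D)
      (Cardinal.ofNat_lt_aleph0.le.trans (Cardinal.aleph0_le_mk D)) two_ne_zero
  obtain ⟨f⟩ := Cardinal.eq.1 hc
  have := Red.par' (V := V) (fun _ : D => ∅) (fun k => {(f (k, true) : ι), (f (k, false) : ι)})
    (fun _ => ∅) p p' (fun _ _ _ => by simp) ?_ ?_
  · have e : (⋃ k : D, {(f (k, true) : ι), (f (k, false) : ι)}) = D := by
      ext x
      simp only [Set.mem_iUnion, Set.mem_insert_iff, Set.mem_singleton_iff]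
      constructor
      · rintro ⟨k, rfl | rfl⟩ <;> exact Subtype.coe_prop _
      · intro hx
        obtain ⟨⟨k, b⟩, hk⟩ := f.surjective ⟨x, hx⟩
        refine ⟨k, ?_⟩
        cases b <;> simp [hk]
    rw [e] at this
    simpa using this
  · intro k l hkl
    rw [Set.disjoint_left]
    rintro x hx hx'
    simp only [Set.mem_insert_iff, Set.mem_singleton_iff] at hx hx'
    rcases hx with rfl | rfl <;> rcases hx' with h | h <;>
      · have := f.injective (Subtype.ext h)
        simp only [Prod.mk.injEq] at this
        exact hkl this.1
  · intro k
    refine Red.pair ?_ ?_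
    · intro h
      have := f.injective (Subtype.ext h)
      simp at this
    · rw [hp _ (f (k, true)).2 _ (f (k, false)).2]
      exact Rch.refl _

theorem pairing {D : Set ι} {p : ι → V}
    (hp : ∀ i ∈ D, ∀ j ∈ D, p i = p j) : ∃ D' : Set ι, D'.Subsingleton ∧ Red ∅ D p D' p := by
  by_cases hD : D.Infinite
  · exact ⟨∅, Set.subsingleton_empty, pairing_inf hD hp⟩
  rw [Set.not_infinite] at hD
  induction D, hD using Set.Finite.induction_on with
  | empty => exact ⟨∅, Set.subsingleton_empty, Red.id⟩
  | @insert a S ha _ ih =>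
    obtain ⟨D', h1, h2⟩ := ih fun i hi j hj => hp i (Or.inr hi) j (Or.inr hj)
    have h3 : Red ∅ (insert a S) p (insert a D') p := by
      have := Red.union (D₁ := {a}) (by simp) (by simpa using ha) (Red.id (p := p)) h2
      simpa [Set.singleton_union] using this
    rcases h1.eq_empty_or_singleton with rfl | ⟨b, rfl⟩
    · exact ⟨{a}, Set.subsingleton_singleton, by simpa using h3⟩
    · refine ⟨∅, Set.subsingleton_empty, ?_⟩
      have hb : b ∈ S := h2.subset rfl
      have h4 : Red ∅ {a, b} p ∅ p := Red.pair (by rintro rfl; exact ha hb)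
        (by rw [hp a (Or.inl rfl) b (Or.inr hb)]; exact Rch.refl _)
      simpa using Red.comp (by simp) h3 h4

/-- Reduce tokens at each vertex to at most one. -/
theorem pairing_all (D : Set ι) (p : ι → V) : ∃ D' : Set ι, Set.InjOn p D' ∧ Red ∅ D p D' p := by
  have h : ∀ v : V, ∃ D' : Set ι, D'.Subsingleton ∧ Red ∅ {i ∈ D | p i = v} p D' p := fun v =>
    pairing fun i hi j hj => hi.2.trans hj.2.symm
  choose D' h1 h2 using h
  refine ⟨⋃ v, D' v, ?_, ?_⟩
  · intro i hi j hj hij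
    obtain ⟨v, hv⟩ := Set.mem_iUnion.1 hi
    obtain ⟨w, hw⟩ := Set.mem_iUnion.1 hj
    have e1 := ((h2 v).subset hv).2
    have e2 := ((h2 w).subset hw).2
    have : v = w := by rw [← e1, ← e2, hij]
    subst this
    exact h1 v hv hw
  · have := Red.par' _ _ _ p p (fun _ _ _ => by simp) ?_ h2
    · have e : (⋃ v, {i ∈ D | p i = v}) = D := by ext; simp
      rw [e] at this
      simpa using this
    · intro v w hvw
      rw [Set.disjoint_left]
      rintro x ⟨_, rfl⟩ ⟨_, h⟩
      exact hvw h

/-! ### Trails -/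

theorem trail_one {G : SimpleGraph V} {u v : V} (w : G.Walk u v) (hw : w.IsTrail) (D : Set ι)
    (p : ι → V) (hp : ∀ i ∈ D, p i ∈ w.support) :
    ∃ D' : Set ι, D'.Subsingleton ∧ Red {e | e ∈ w.edges} D p D' (fun _ => v) := by
  classical
  induction w generalizing D p with
  | nil =>
    simp only [Walk.support_nil, List.mem_singleton] at hp
    obtain ⟨D', h1, h2⟩ := pairing (D := D) (p := p) fun i hi j hj => by rw [hp i hi, hp j hj]
    exact ⟨D', h1, (h2.mono (by simp)).congr (fun _ _ => rfl) fun i hi => hp i (h2.subset hi)⟩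
  | @cons u u' v h w ih =>
    rw [Walk.isTrail_cons] at hw
    obtain ⟨Du, a1, a2⟩ := pairing (D := {i ∈ D | p i = u}) (p := p) fun i hi j hj =>
      hi.2.trans hj.2.symm
    set R : Set ι := {i ∈ D | p i ≠ u} with hR
    have hDR : Disjoint {i ∈ D | p i = u} R := by
      rw [Set.disjoint_left]; rintro x ⟨_, h⟩ ⟨_, h'⟩; exact h' h
    have hun : {i ∈ D | p i = u} ∪ R = D := by
      ext x; simp only [hR, Set.mem_union, Set.mem_ofPred_eq]; tauto
    have s1 : Red ∅ D p (Du ∪ R) p := by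
      have := Red.union (by simp) hDR a2 (Red.id (p := p))
      rw [hun] at this
      simpa using this
    set p2 : ι → V := fun i => if i ∈ R then p i else u' with hp2
    have hDuR : ∀ i ∈ Du, i ∉ R := fun i hi => Set.disjoint_left.1 hDR (a2.subset hi)
    have s2 : Red {s(u, u')} (Du ∪ R) p (Du ∪ R) p2 := by
      have m : Red {s(u, u')} Du p Du p2 := by
        rcases a1.eq_empty_or_singleton with rfl | ⟨i, rfl⟩
        · exact (Red.id (p := p)).mono (by simp) |>.congr (fun _ _ => rfl) (by simp)
        · apply Red.move
          have e1 : p i = u := (a2.subset rfl).2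
          have e2 : p2 i = u' := by simp [hp2, hDuR i rfl]
          rw [e1, e2]
          exact Rch.single (Set.mem_singleton _)
      have m2 : Red (∅ : Set (Sym2 V)) R p R p2 :=
        (Red.id (p := p)).congr (fun _ _ => rfl) fun i hi => by simp [hp2, hi]
      simpa using Red.union (by simp) (Set.disjoint_left.2 hDuR) m m2
    obtain ⟨D', b1, b2⟩ := ih hw.1 (Du ∪ R) p2 (by
      rintro i (hi | hi)
      · simp [hp2, hDuR i hi]
      · have := hp i hi.1
        simp only [Walk.support_cons, List.mem_cons] at this
        simp only [hp2, hi, if_true]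
        exact this.resolve_left hi.2)
    refine ⟨D', b1, ?_⟩
    have := Red.comp (by simpa using hw.2) (Red.comp (by simp) s1 s2) b2
    refine this.mono ?_
    intro e he
    simpa using he

theorem trail_two {G : SimpleGraph V} {u v : V} (w : G.Walk u v) (hw : w.IsTrail) (D : Set ι)
    (p : ι → V) (hp : ∀ i ∈ D, p i ∈ w.support) (hne : D.Nonempty) :
    ∃ i₀, ∃ D' : Set ι, D'.Subsingleton ∧ i₀ ∉ D' ∧ ∃ p' : ι → V, p' i₀ = u ∧ (∀ i ∈ D', p' i = v) ∧
      Red {e | e ∈ w.edges} D p ({i₀} ∪ D') p' := by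
  classical
  induction w with
  | @nil u =>
    obtain ⟨i, hi⟩ := hne
    obtain ⟨D', h1, h2⟩ := trail_one (Walk.nil : G.Walk u u) hw (D \ {i}) p
      (fun j hj => hp j hj.1)
    have h3 := Red.union (by simp) (by simp) (Red.move (E := (∅ : Set (Sym2 V))) (i := i) (p := p)
      (p' := fun _ => u) (by have := hp i hi; simp at this; rw [this]; exact Rch.refl _)) h2
    refine ⟨i, D', h1, fun h => (h2.subset h).2 rfl, fun _ => u, rfl, fun _ _ => rfl, ?_⟩
    have e : {i} ∪ D \ {i} = D := by simp [Set.insert_eq_of_mem hi]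
    rw [e] at h3
    simpa using h3
  | @cons u u' v h w ih =>
    by_cases hu : ∃ i ∈ D, p i = u
    · obtain ⟨i, hi, hiu⟩ := hu
      obtain ⟨D', h1, h2⟩ := trail_one (Walk.cons h w) hw (D \ {i}) p
        (fun j hj => hp j hj.1)
      have hi' : i ∉ D' := fun h => (h2.subset h).2 rfl
      let q : ι → V := fun j => if j = i then u else v
      have h2' := h2.congr (q' := q) (fun _ _ => rfl) fun j hj => by
        simp only [q]; rw [if_neg]; rintro rfl; exact hi' hj
      have h3 := Red.union (by simp) (by simp) (Red.move (E := (∅ : Set (Sym2 V))) (i := i)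
        (p := p) (p' := q) (by simp only [q, if_true, hiu]; exact Rch.refl _)) h2'
      refine ⟨i, D', h1, hi', q, by simp [q], fun j hj => ?_, ?_⟩
      · simp only [q]; rw [if_neg]; rintro rfl; exact hi' hj
      have e : {i} ∪ D \ {i} = D := by simp [Set.insert_eq_of_mem hi]
      rw [e] at h3
      simpa using h3
    · rw [Walk.isTrail_cons] at hw
      push Not at hu
      obtain ⟨i, D', h1, h2, p', h3, h4, h5⟩ := ih hw.1 (fun i hi => by
        have := hp i hi
        simp only [Walk.support_cons, List.mem_cons] at this
        exact this.resolve_left (hu i hi))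
      let q : ι → V := fun j => if j = i then u else v
      have hq : ∀ j ∈ D', q j = v := fun j hj => by
        simp only [q]; rw [if_neg]; rintro rfl; exact h2 hj
      have m1 : Red {s(u, u')} {i} p' {i} q := Red.move (by
        simp only [q, if_true, h3]; exact (Rch.single (Set.mem_singleton _)).symm)
      have m2 : Red (∅ : Set (Sym2 V)) D' p' D' q :=
        (Red.id (p := p')).congr (fun _ _ => rfl) fun j hj => by rw [hq j hj, h4 j hj]
      refine ⟨i, D', h1, h2, q, by simp [q], hq, ?_⟩
      have := Red.comp (by simpa using hw.2) h5 (Red.union (by simp) (by simpa using h2) m1 m2)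
      refine this.mono ?_
      intro e he
      simpa [or_comm] using he

/-- A complete reduction gives a `T`-join. -/
theorem hasTJoin_of_red {G : SimpleGraph V} {T : Set V} {p' : V → V}
    (h : Red G.edgeSet T (fun v => v) ∅ p') : G.HasTJoin T := by
  classical
  obtain ⟨σ, A, -, h2, -, h4, h5⟩ := h
  simp only [Set.mem_empty_iff_false, not_false_eq_true, forall_true_left, true_and] at h4
  let _ : LinearOrder V := linearOrderOfSTO WellOrderingRel
  have hw : ∀ t : T, ∃ w : G.Walk (t : V) (σ t), w.IsPath ∧ ∀ e ∈ w.edges, e ∈ A t := fun t =>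
    Rch.exists_path (h2 t t.2) (h4 t t.2).2.2.2.2
  choose w hw1 hw2 using hw
  refine ⟨{q | ∃ t : T, (t : V) < σ t ∧ q = ⟨t, σ t, w t⟩}, ?_, ?_, ?_⟩
  · rintro q ⟨t, ht, rfl⟩
    exact ⟨hw1 t, ht.ne, t.2, (h4 t t.2).1⟩
  · rintro q ⟨t, ht, rfl⟩ q' ⟨t', ht', rfl⟩ hne e he he'
    have h1 := hw2 t e he
    have h1' := hw2 t' e he'
    refine Set.disjoint_left.1 (h5 t t.2 t' t'.2 ?_ ?_) h1 h1'
    · intro h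
      exact hne (by rw [Subtype.ext h])
    · intro h
      have h6 := (h4 t t.2).2.2.1
      rw [h, h6] at ht'
      exact lt_asymm ht ht'
  · intro t ht
    obtain ⟨a, b, c, d, e⟩ := h4 t ht
    rcases lt_or_gt_of_ne b with hlt | hlt
    · refine ⟨⟨σ t, σ (σ t), w ⟨σ t, a⟩⟩, ⟨⟨⟨σ t, a⟩, by simpa [c] using hlt, rfl⟩, Or.inr c⟩, ?_⟩
      rintro q ⟨⟨t', ht', rfl⟩, h | h⟩
      · simp only at h
        rw [h] at ht'
        exact absurd ht' (lt_asymm hlt)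
      · simp only at h
        have : t' = ⟨σ t, a⟩ := Subtype.ext (by
          change (t' : V) = σ t
          rw [← h, (h4 t' t'.2).2.2.1])
        rw [this]
    · refine ⟨⟨t, σ t, w ⟨t, ht⟩⟩, ⟨⟨⟨t, ht⟩, hlt, rfl⟩, Or.inl rfl⟩, ?_⟩
      rintro q ⟨⟨t', ht', rfl⟩, h | h⟩
      · simp only at h
        have : t' = ⟨t, ht⟩ := Subtype.ext h
        rw [this]
      · simp only at h
        have : (t' : V) = σ t := by rw [← h, (h4 t' t'.2).2.2.1]
        rw [h, this] at ht'
        exact absurd ht' (lt_asymm hlt)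

end TJ

namespace TJ
open SimpleGraph
variable {V : Type*}

/-- A spanning forest of `G` rooted at `Z`, given by a parent function. -/
structure Frst (G : SimpleGraph V) (Z : Set V) where
  par : V → V
  d : V → ℕ
  adj : ∀ v, v ∉ Z → G.Adj v (par v)
  dep : ∀ v, v ∉ Z → d v = d (par v) + 1
  root : ∀ z, z ∈ Z → par z = z
  dz : ∀ z, z ∈ Z → d z = 0

theorem exists_frst (G : SimpleGraph V) (hG : G.Connected) {Z : Set V} (hZ : Z.Nonempty) :
    Nonempty (Frst G Z) := by
  classical
  have hex : ∀ v, ∃ n, ∃ z ∈ Z, ∃ w : G.Walk v z, w.length = n := fun v => by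
    obtain ⟨z, hz⟩ := hZ
    obtain ⟨w⟩ := hG.preconnected v z
    exact ⟨_, z, hz, w, rfl⟩
  let d : V → ℕ := fun v => Nat.find (hex v)
  have hd : ∀ v z, z ∈ Z → ∀ w : G.Walk v z, d v ≤ w.length := fun v z hz w =>
    Nat.find_min' (hex v) ⟨z, hz, w, rfl⟩
  have key : ∀ v, v ∉ Z → ∃ u, G.Adj v u ∧ d v = d u + 1 := fun v hv => by
    obtain ⟨z, hz, w, hw⟩ := Nat.find_spec (hex v)
    change w.length = d v at hw
    cases w with
    | nil => exact absurd hz hv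
    | @cons _ u _ h w =>
      refine ⟨u, h, le_antisymm ?_ ?_⟩
      · obtain ⟨z', hz', w', hw'⟩ := Nat.find_spec (hex u)
        change w'.length = d u at hw'
        have := hd v z' hz' (Walk.cons h w')
        rwa [Walk.length_cons, hw'] at this
      · have := hd u z hz w
        rw [← hw, Walk.length_cons]
        omega
  choose f hf1 hf2 using key
  refine ⟨⟨fun v => if h : v ∈ Z then v else f v h, d, ?_, ?_, ?_, ?_⟩⟩
  · intro v hv; simp only [hv, dif_neg, not_false_eq_true]; exact hf1 v hv
  · intro v hv; simp only [hv, dif_neg, not_false_eq_true]; exact hf2 v hv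
  · intro v hv; simp [hv]
  · intro z hz
    exact Nat.le_zero.1 (hd z z hz Walk.nil)

namespace Frst
variable {G : SimpleGraph V} {Z : Set V} (S : Frst G Z)

/-- `x` is an ancestor of `t`. -/
def B (x t : V) : Prop := ∃ n, S.par^[n] t = x

/-- The non-root ancestors of `t`. -/
def up (t : V) : Set V := {x | x ∉ Z ∧ S.B x t}

/-- The edge from `x` to its parent. -/
def ed (x : V) : Sym2 V := s(x, S.par x)

theorem B_refl (t : V) : S.B t t := ⟨0, rfl⟩
theorem B_trans {x y z : V} (h : S.B x y) (h' : S.B y z) : S.B x z := by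
  obtain ⟨n, rfl⟩ := h
  obtain ⟨m, rfl⟩ := h'
  exact ⟨n + m, Function.iterate_add_apply _ _ _ _⟩
theorem B_par (x : V) : S.B (S.par x) x := ⟨1, rfl⟩

theorem B_total {x y t : V} (h : S.B x t) (h' : S.B y t) : S.B x y ∨ S.B y x := by
  obtain ⟨n, rfl⟩ := h
  obtain ⟨m, rfl⟩ := h'
  rcases le_total n m with h | h
  · right
    exact ⟨m - n, by rw [← Function.iterate_add_apply, Nat.sub_add_cancel h]⟩
  · left
    exact ⟨n - m, by rw [← Function.iterate_add_apply, Nat.sub_add_cancel h]⟩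

theorem iter_Z {z : V} (hz : z ∈ Z) (n : ℕ) : S.par^[n] z = z :=
  Function.iterate_fixed (S.root z hz) n

theorem B_notZ {x t : V} (h : S.B x t) (hx : x ∉ Z) : t ∉ Z := by
  obtain ⟨n, rfl⟩ := h
  intro ht
  rw [S.iter_Z ht] at hx
  exact hx ht

theorem d_iter {t : V} {n : ℕ} (h : S.par^[n] t ∉ Z) : S.d t = S.d (S.par^[n] t) + n := by
  induction n generalizing t with
  | zero => rfl
  | succ n ih =>
    rw [Function.iterate_succ_apply] at h ⊢
    have ht : t ∉ Z := S.B_notZ (S.B_trans ⟨n, rfl⟩ (S.B_par t)) h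
    rw [S.dep t ht, ih h]
    omega

theorem B_le {x t : V} (h : S.B x t) (hx : x ∉ Z) : S.d x ≤ S.d t := by
  obtain ⟨n, rfl⟩ := h
  rw [S.d_iter hx]; omega

theorem B_lt {x t : V} (h : S.B x t) (hx : x ∉ Z) (hne : x ≠ t) : S.d x < S.d t := by
  obtain ⟨n, rfl⟩ := h
  rw [S.d_iter hx]
  rcases n with _ | n
  · exact absurd rfl hne
  · omega

theorem iter_eq {t : V} {n m : ℕ} (h : S.par^[n] t ∉ Z) (e : S.par^[n] t = S.par^[m] t) :
    n = m := by
  have h1 := S.d_iter h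
  rw [e] at h h1
  have h2 := S.d_iter h
  omega

theorem reach_Z (t : V) : S.par^[S.d t] t ∈ Z := by
  by_contra h
  have h1 := S.d_iter h
  have h2 := S.dep _ h
  omega

theorem ed_mem {x : V} (hx : x ∉ Z) : S.ed x ∈ G.edgeSet := S.adj x hx

theorem ed_inj {x y : V} (hx : x ∉ Z) (hy : y ∉ Z) (h : S.ed x = S.ed y) : x = y := by
  rw [ed, ed, Sym2.eq_iff] at h
  rcases h with h | h
  · exact h.1
  · have h1 := S.dep x hx
    have h2 := S.dep y hy
    rw [h.2] at h1
    rw [← h.1] at h2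
    omega

theorem disj_ed {s t : Set V} (hs : s ⊆ Zᶜ) (ht : t ⊆ Zᶜ) (h : Disjoint s t) :
    Disjoint (S.ed '' s) (S.ed '' t) := by
  rw [Set.disjoint_left]
  rintro _ ⟨x, hx, rfl⟩ ⟨y, hy, e⟩
  have := S.ed_inj (ht hy) (hs hx) e
  subst this
  exact Set.disjoint_left.1 h hx hy

theorem reach {t : V} {n : ℕ} {s : Set V} (h : ∀ i < n, S.par^[i] t ∉ Z → S.par^[i] t ∈ s) :
    Rch (S.ed '' s) t (S.par^[n] t) := by
  induction n with
  | zero => exact Rch.refl _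
  | succ n ih =>
    refine (ih fun i hi => h i (by omega)).trans ?_
    rw [Function.iterate_succ_apply']
    by_cases hz : S.par^[n] t ∈ Z
    · rw [S.root _ hz]; exact Rch.refl _
    · exact Rch.single ⟨_, h n (by omega) hz, rfl⟩

end Frst

/-- An injective depth-increasing function admits a perfect matching along its arcs. -/
theorem exists_alt {X : Type*} (n : X → X) (hn : Function.Injective n) (d : X → ℕ)
    (hd : ∀ x, d x < d (n x)) :
    ∃ c : X → Prop, (∀ x, c (n x) ↔ ¬ c x) ∧ ∀ x, ¬ c x → ∃ y, n y = x := by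
  classical
  have wf : WellFounded (fun a b : X => d a < d b) := (measure d).wf
  let c : X → Prop := wf.fix fun x ih => if h : ∃ y, n y = x then
    ¬ ih h.choose (by have := hd h.choose; rwa [h.choose_spec] at this) else True
  have hc : ∀ x, c x = if h : ∃ y, n y = x then ¬ c h.choose else True := fun x => wf.fix_eq _ x
  refine ⟨c, fun x => ?_, fun x hx => ?_⟩
  · have h : ∃ y, n y = n x := ⟨x, rfl⟩
    have e : h.choose = x := hn h.choose_spec
    rw [hc (n x), dif_pos h, e]
  · by_contra h
    rw [hc x, dif_neg h] at hx
    exact hx trivial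

/-- A good family of pairs in the forest: triples `(t, t', E)`. -/
def Good {G : SimpleGraph V} {Z : Set V} (S : Frst G Z) (D : Set V)
    (Q : Set (V × V × Set V)) : Prop :=
  (∀ q ∈ Q, q.1 ∈ D ∧ q.2.1 ∈ D ∧ q.1 ≠ q.2.1 ∧ q.2.2 ⊆ Zᶜ ∧ Rch (S.ed '' q.2.2) q.1 q.2.1) ∧
  (∀ q ∈ Q, ∀ q' ∈ Q, q ≠ q' → Disjoint ({q.1, q.2.1} : Set V) {q'.1, q'.2.1} ∧
    Disjoint q.2.2 q'.2.2) ∧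
  (∀ u ∈ D, (∀ q ∈ Q, u ≠ q.1 ∧ u ≠ q.2.1) → ∀ q ∈ Q, Disjoint (S.up u) q.2.2)

theorem exists_good {G : SimpleGraph V} {Z : Set V} (S : Frst G Z) (D : Set V) :
    ∃ Q, Maximal (Good S D) Q := by
  have key : ∀ c ⊆ {Q | Good S D Q}, IsChain (· ⊆ ·) c → ∃ ub ∈ {Q | Good S D Q}, ∀ s ∈ c, s ⊆ ub := ?_
  · obtain ⟨Q, hQ⟩ := zorn_subset {Q | Good S D Q} key
    exact ⟨Q, hQ⟩
  intro c hc hchain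
  refine ⟨⋃₀ c, ⟨?_, ?_, ?_⟩, fun s hs => Set.subset_sUnion_of_mem hs⟩
  · rintro q ⟨Q, hQ, hq⟩
    exact (hc hQ).1 q hq
  · rintro q ⟨Q, hQ, hq⟩ q' ⟨Q', hQ', hq'⟩ hne
    rcases hchain.total hQ hQ' with h | h
    · exact (hc hQ').2.1 q (h hq) q' hq' hne
    · exact (hc hQ).2.1 q hq q' (h hq') hne
  · rintro u hu h q ⟨Q, hQ, hq⟩
    exact (hc hQ).2.2 u hu (fun q' hq' => h q' ⟨Q, hQ, hq'⟩) q hq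

set_option maxHeartbeats 4000000 in
theorem claimA {G : SimpleGraph V} {Z : Set V} (S : Frst G Z) (D : Set V) (hDZ : D ⊆ Zᶜ) :
    ∃ D' : Set V, ∃ p' : V → V, (∀ i ∈ D', p' i ∈ Z) ∧
      Red (S.ed '' Zᶜ) D (fun v => v) D' p' := by
  classical
  obtain ⟨Q, ⟨g1, g2, g3⟩, hmax⟩ := exists_good S D
  set U : Set V := {u ∈ D | ∀ q ∈ Q, u ≠ q.1 ∧ u ≠ q.2.1} with hU
  set EQ : Set V := ⋃ q : Q, q.1.2.2 with hEQ
  have hUEQ : ∀ u ∈ U, Disjoint (S.up u) EQ := fun u hu =>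
    Set.disjoint_iUnion_right.2 fun q => g3 u hu.1 hu.2 q q.2
  have hEQZ : EQ ⊆ Zᶜ := Set.iUnion_subset fun q => (g1 q q.2).2.2.2.1
  -- the pairs in `Q`
  set DQ : Set V := ⋃ q : Q, {q.1.1, q.1.2.1} with hDQ
  have redQ : Red (S.ed '' EQ) DQ (fun v => v) ∅ (fun v => S.par^[S.d v] v) := by
    have := Red.par' (fun q : Q => S.ed '' q.1.2.2) (fun q => {q.1.1, q.1.2.1}) (fun _ => ∅)
      (fun v => v) (fun v => S.par^[S.d v] v) ?_ ?_ ?_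
    · rw [hEQ, hDQ, Set.image_iUnion]
      simpa using this
    · intro q q' h
      exact S.disj_ed (g1 q q.2).2.2.2.1 (g1 q' q'.2).2.2.2.1
        (g2 q q.2 q' q'.2 fun e => h (Subtype.ext e)).2
    · intro q q' h
      exact (g2 q q.2 q' q'.2 fun e => h (Subtype.ext e)).1
    · intro q
      exact Red.pair (g1 q q.2).2.2.1 (g1 q q.2).2.2.2.2
  -- branching vertices
  set A : Set V := {v | ∃ u ∈ U, ∃ u' ∈ U, u ≠ u' ∧ v ∈ S.up u ∧ v ∈ S.up u'} with hA
  have hAZ : A ⊆ Zᶜ := by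
    rintro v ⟨u, _, u', _, _, h, _⟩
    exact h.1
  have hAdown : ∀ x y, S.B x y → x ∉ Z → y ∈ A → x ∈ A := by
    rintro x y hxy hx ⟨u, hu, u', hu', hne, h, h'⟩
    exact ⟨u, hu, u', hu', hne, ⟨hx, S.B_trans hxy h.2⟩, ⟨hx, S.B_trans hxy h'.2⟩⟩
  set U1 : Set V := {u ∈ U | ∃ x ∈ A, S.B x u} with hU1
  set U2 : Set V := {u ∈ U | ¬ ∃ x ∈ A, S.B x u} with hU2
  have upZ : ∀ u, S.up u ⊆ Zᶜ := fun u x hx => hx.1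
  have red2 : Red (S.ed '' (⋃ u : U2, S.up u)) U2 (fun v => v) U2
      (fun v => S.par^[S.d v] v) := by
    have := Red.par' (fun u : U2 => S.ed '' S.up u) (fun u => {u.1}) (fun u => {u.1})
      (fun v => v) (fun v => S.par^[S.d v] v) ?_ ?_ ?_
    · rw [Set.image_iUnion]
      simpa using this
    · intro u u' h
      refine S.disj_ed (upZ _) (upZ _) ?_
      rw [Set.disjoint_left]
      intro x hx hx'
      exact u.2.2 ⟨x, ⟨u, u.2.1, u', u'.2.1, fun e => h (Subtype.ext e), hx, hx'⟩, hx.2⟩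
    · intro u u' h
      simpa using fun e => h (Subtype.ext e)
    · intro u
      exact Red.move (S.reach fun i _ hz => ⟨hz, i, rfl⟩)
  -- first branching vertex of a token
  have hex : ∀ u : U1, ∃ n, S.par^[n] u ∈ A := fun u => by
    obtain ⟨x, hx, n, rfl⟩ := u.2.2
    exact ⟨n, hx⟩
  set nn : U1 → ℕ := fun u => Nat.find (hex u) with hnn
  set a : U1 → V := fun u => S.par^[nn u] u with ha
  have haA : ∀ u, a u ∈ A := fun u => Nat.find_spec (hex u)
  have hamin : ∀ u, ∀ i < nn u, S.par^[i] u ∉ A := fun u i hi => Nat.find_min (hex u) hi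
  set hang : U1 → Set V := fun u => {x | x ∉ Z ∧ x ∉ A ∧ S.B x u} with hhang
  have hangZ : ∀ u, hang u ⊆ Zᶜ := fun u x hx => hx.1
  have hangdisj : ∀ u u' : U1, u ≠ u' → Disjoint (hang u) (hang u') := fun u u' h => by
    rw [Set.disjoint_left]
    intro x hx hx'
    exact hx.2.1 ⟨u, u.2.1, u', u'.2.1, fun e => h (Subtype.ext e), ⟨hx.1, hx.2.2⟩,
      ⟨hx.1, hx'.2.2⟩⟩
  have hangreach : ∀ u : U1, Rch (S.ed '' hang u) u (a u) := fun u =>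
    S.reach fun i hi hz => ⟨hz, hamin u i hi, i, rfl⟩
  have haB : ∀ u : U1, ∀ x ∈ A, S.B x u → S.B x (a u) := by
    rintro u x hx ⟨m, rfl⟩
    have : nn u ≤ m := by
      by_contra h
      exact hamin u m (by omega) hx
    exact ⟨m - nn u, by rw [ha, ← Function.iterate_add_apply, Nat.sub_add_cancel this]⟩
  have ainj : Function.Injective a := by
    intro u u' e
    by_contra hne
    have hne' : (u : V) ≠ u' := fun h => hne (Subtype.ext h)
    have hsub : hang u ⊆ S.up u := fun x hx => ⟨hx.1, hx.2.2⟩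
    have hsub' : hang u' ⊆ S.up u' := fun x hx => ⟨hx.1, hx.2.2⟩
    let q0 : V × V × Set V := (u, u', hang u ∪ hang u')
    have hgood : Good S D (insert q0 Q) := by
      refine ⟨?_, ?_, ?_⟩
      · rintro q (rfl | hq)
        · refine ⟨u.2.1.1, u'.2.1.1, hne', Set.union_subset (hangZ _) (hangZ _), ?_⟩
          refine ((hangreach u).mono ?_).trans (?_ : Rch _ (a u) _)
          · exact Set.image_mono Set.subset_union_left
          · rw [e]
            exact (hangreach u').symm.mono (Set.image_mono Set.subset_union_right)
        · exact g1 q hq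
      · have key : ∀ q ∈ Q, Disjoint ({(u : V), (u' : V)} : Set V) {q.1, q.2.1} ∧
            Disjoint (hang u ∪ hang u') q.2.2 := fun q hq => by
          refine ⟨?_, ?_⟩
          · have h1 := u.2.1.2 q hq
            have h2 := u'.2.1.2 q hq
            rw [Set.disjoint_left]
            rintro x (rfl | rfl) (h | h)
            · exact h1.1 h
            · exact h1.2 h
            · exact h2.1 h
            · exact h2.2 h
          · rw [Set.disjoint_union_left]
            exact ⟨(g3 u u.2.1.1 u.2.1.2 q hq).mono_left hsub,
              (g3 u' u'.2.1.1 u'.2.1.2 q hq).mono_left hsub'⟩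
        rintro q (rfl | hq) q' (rfl | hq') hqq
        · exact absurd rfl hqq
        · exact key q' hq'
        · exact ⟨(key q hq).1.symm, (key q hq).2.symm⟩
        · exact g2 q hq q' hq' hqq
      · intro w hw hwQ
        have hwU : w ∈ U := ⟨hw, fun q hq => hwQ q (Or.inr hq)⟩
        have h0 := hwQ q0 (Or.inl rfl)
        rintro q (rfl | hq)
        · change Disjoint _ (hang u ∪ hang u')
          rw [Set.disjoint_left]
          rintro x hx (hx' | hx')
          · exact hx'.2.1 ⟨w, hwU, u, u.2.1, h0.1, hx, ⟨hx.1, hx'.2.2⟩⟩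
          · exact hx'.2.1 ⟨w, hwU, u', u'.2.1, h0.2, hx, ⟨hx.1, hx'.2.2⟩⟩
        · exact g3 w hw hwU.2 q hq
    have := hmax hgood (Set.subset_insert _ _) (Set.mem_insert q0 Q)
    exact (u.2.1.2 q0 this).1 rfl
  -- nearest token position strictly above
  have hnext : ∀ u : U1, ∃ m, ∃ u' : U1, S.par^[m + 1] (a u') = a u := by
    intro u
    obtain ⟨u1, h1, u2, h2, hne, b1, b2⟩ := haA u
    have k1 : u1 ∈ U1 := ⟨h1, a u, haA u, b1.2⟩
    have k2 : u2 ∈ U1 := ⟨h2, a u, haA u, b2.2⟩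
    have aux : ∀ u' : U1, S.B (a u) u' → a u' ≠ a u →
        ∃ m, ∃ u' : U1, S.par^[m + 1] (a u') = a u := by
      intro u' hB hneq
      obtain ⟨m, hm⟩ := haB u' _ (haA u) hB
      rcases m with _ | m
      · exact absurd hm hneq
      · exact ⟨m, u', hm⟩
    by_cases h : a ⟨u1, k1⟩ = a u
    · refine aux ⟨u2, k2⟩ b2.2 fun h' => hne ?_
      have := ainj (h.trans h'.symm)
      exact congrArg Subtype.val this
    · exact aux ⟨u1, k1⟩ b1.2 h
  set hh : U1 → ℕ := fun u => Nat.find (hnext u) with hhh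
  have hspec : ∀ u : U1, ∃ u' : U1, S.par^[hh u + 1] (a u') = a u := fun u =>
    Nat.find_spec (hnext u)
  choose nx hnx using hspec
  have hmin : ∀ u u' : U1, ∀ m, S.par^[m + 1] (a u') = a u → hh u ≤ m := fun u u' m h =>
    Nat.find_min' (hnext u) ⟨u', h⟩
  set seg : U1 → Set V := fun u => {x | ∃ i ≤ hh u, S.par^[i] (a (nx u)) = x} with hseg
  have aZ : ∀ u, a u ∉ Z := fun u => hAZ (haA u)
  have segB : ∀ u, ∀ x ∈ seg u, x ∉ Z ∧ ∃ j ≤ hh u, S.par^[j + 1] x = a u := by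
    rintro u x ⟨i, hi, rfl⟩
    have e : S.par^[hh u - i + 1] (S.par^[i] (a (nx u))) = a u := by
      have e0 : hh u - i + 1 + i = hh u + 1 := by omega
      rw [← Function.iterate_add_apply, e0, hnx u]
    refine ⟨?_, hh u - i, by omega, e⟩
    refine S.B_notZ ⟨_, e⟩ (aZ u)
  have segA : ∀ u, seg u ⊆ A := by
    rintro u x hx
    have h1 := (segB u x hx).1
    obtain ⟨i, hi, rfl⟩ := hx
    exact hAdown _ _ ⟨i, rfl⟩ h1 (haA _)
  have segdisj : ∀ u u', u ≠ u' → Disjoint (seg u) (seg u') := by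
    have aux : ∀ u u' x j j', x ∈ seg u → S.par^[j + 1] x = a u → S.par^[j' + 1] x = a u' →
        j' < j → False := by
      intro u u' x j j' hx e e' hlt
      have e2 : S.par^[(j - j' - 1) + 1] (a u') = a u := by
        have e3 : (j - j' - 1) + 1 + (j' + 1) = j + 1 := by omega
        rw [← e', ← Function.iterate_add_apply, e3, e]
      have h1 := hmin u u' _ e2
      obtain ⟨j₀, hj₀, e₀⟩ := (segB u x hx).2
      have : j + 1 = j₀ + 1 := S.iter_eq (t := x) (by rw [e]; exact aZ u) (by rw [e, e₀])
      omega
    intro u u' hne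
    rw [Set.disjoint_left]
    intro x hx hx'
    obtain ⟨j, hj, e⟩ := (segB u x hx).2
    obtain ⟨j', hj', e'⟩ := (segB u' x hx').2
    rcases lt_trichotomy j j' with h | h | h
    · exact aux u' u x j' j hx' e' e h
    · subst h
      exact hne (ainj (e.symm.trans e'))
    · exact aux u u' x j j' hx e e' h
  have nxseg : ∀ u, a (nx u) ∈ seg u := fun u => ⟨0, Nat.zero_le _, rfl⟩
  have nxinj : Function.Injective nx := by
    intro u u' e
    by_contra hne
    refine Set.disjoint_left.1 (segdisj u u' hne) (nxseg u) ?_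
    rw [e]; exact nxseg u'
  have nxd : ∀ u, S.d (a u) < S.d (a (nx u)) := by
    intro u
    have := S.d_iter (t := a (nx u)) (n := hh u + 1) (by rw [hnx]; exact aZ u)
    rw [hnx] at this
    omega
  obtain ⟨c, hc1, hc2⟩ := exists_alt nx nxinj (fun u => S.d (a u)) nxd
  have segreach : ∀ u, Rch (S.ed '' seg u) (a (nx u)) (a u) := fun u => by
    rw [← hnx u]
    exact S.reach fun i hi _ => ⟨i, by omega, rfl⟩
  -- moving to the first branching vertices and pairing there
  obtain ⟨p1, hp1⟩ : ∃ p1 : V → V, ∀ u : U1, p1 u = a u :=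
    ⟨fun v => if h : v ∈ U1 then a ⟨v, h⟩ else v, fun u => by simp⟩
  have red1a : Red (S.ed '' (⋃ u : U1, hang u)) U1 (fun v => v) U1 p1 := by
    have := Red.par' (fun u : U1 => S.ed '' hang u) (fun u => {u.1}) (fun u => {u.1})
      (fun v => v) p1 ?_ ?_ ?_
    · rw [Set.image_iUnion]
      simpa using this
    · intro u u' h
      exact S.disj_ed (hangZ _) (hangZ _) (hangdisj u u' h)
    · intro u u' h
      simpa using fun e => h (Subtype.ext e)
    · intro u
      refine Red.move ?_
      rw [hp1]
      exact hangreach u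
  have red1b : Red (S.ed '' A) U1 p1 ∅ (fun v => S.par^[S.d v] v) := by
    have := Red.par' (fun u : {u : U1 // c u} => S.ed '' seg u)
      (fun u => {(u.1 : V), (nx u.1 : V)}) (fun u => ∅)
      p1 (fun v => S.par^[S.d v] v) ?_ ?_ ?_
    · have e : (⋃ u : {u : U1 // c u}, {(u.1 : V), (nx u.1 : V)}) = U1 := by
        ext x
        simp only [Set.mem_iUnion, Set.mem_insert_iff, Set.mem_singleton_iff]
        constructor
        · rintro ⟨u, rfl | rfl⟩ <;> exact Subtype.coe_prop _
        · intro hx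
          by_cases hcx : c ⟨x, hx⟩
          · exact ⟨⟨⟨x, hx⟩, hcx⟩, Or.inl rfl⟩
          · obtain ⟨y, hy⟩ := hc2 _ hcx
            have hcy : c y := by
              by_contra h
              exact hcx (by rw [← hy]; exact (hc1 y).2 h)
            exact ⟨⟨y, hcy⟩, Or.inr (by rw [hy])⟩
      rw [e] at this
      simp only [Set.iUnion_empty] at this
      refine this.mono (Set.iUnion_subset fun u => Set.image_mono (segA _))
    · intro u u' h
      exact S.disj_ed ((segA _).trans hAZ) ((segA _).trans hAZ)
        (segdisj _ _ fun e => h (Subtype.ext e))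
    · intro u u' h
      rw [Set.disjoint_left]
      have k : ∀ u u' : {u : U1 // c u}, (u : U1) ≠ nx u' := fun u u' e =>
        (hc1 u'.1).1 (by rw [← e]; exact u.2) u'.2
      rintro x (rfl | rfl) (h' | h')
      · exact h (Subtype.ext (Subtype.ext h'))
      · exact k u u' (Subtype.ext h')
      · exact k u' u (Subtype.ext h'.symm)
      · exact h (Subtype.ext (nxinj (Subtype.ext h')))
    · intro u
      refine Red.pair ?_ ?_
      · intro e
        have e' := Subtype.ext e
        have := nxd u.1
        rw [← e'] at this
        exact lt_irrefl _ this
      · rw [hp1, hp1]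
        exact (segreach u.1).symm
  have dHA : Disjoint (⋃ u : U1, hang u) A := by
    rw [Set.disjoint_left]
    intro x hx hx'
    obtain ⟨u, hu⟩ := Set.mem_iUnion.1 hx
    exact hu.2.1 hx'
  have hangUZ : (⋃ u : U1, hang u) ⊆ Zᶜ := Set.iUnion_subset hangZ
  have red1 := Red.comp (S.disj_ed hangUZ hAZ dHA) red1a red1b
  rw [← Set.image_union] at red1
  have U2Z : (⋃ u : U2, S.up u) ⊆ Zᶜ := Set.iUnion_subset fun u => upZ u
  have X1Z : (⋃ u : U1, hang u) ∪ A ⊆ Zᶜ := Set.union_subset hangUZ hAZ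
  have d12 : Disjoint ((⋃ u : U1, hang u) ∪ A) (⋃ u : U2, S.up u) := by
    rw [Set.disjoint_left]
    rintro x hx hx'
    obtain ⟨u2, hu2⟩ := Set.mem_iUnion.1 hx'
    rcases hx with hx | hx
    · obtain ⟨u, hu⟩ := Set.mem_iUnion.1 hx
      have hne : (u : V) ≠ u2 := fun e => by
        have h1 := u.2.2
        rw [e] at h1
        exact u2.2.2 h1
      exact hu.2.1 ⟨u, u.2.1, u2, u2.2.1, hne, ⟨hu.1, hu.2.2⟩, hu2⟩
    · exact u2.2.2 ⟨x, hx, hu2.2⟩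
  have dU12 : Disjoint U1 U2 := by
    rw [Set.disjoint_left]
    intro x h h'
    exact h'.2 h.2
  have redU := Red.union (S.disj_ed X1Z U2Z d12) dU12 red1 red2
  rw [← Set.image_union] at redU
  have hXup : ((⋃ u : U1, hang u) ∪ A) ∪ (⋃ u : U2, S.up u) ⊆ ⋃ u : U, S.up u := by
    rintro x ((hx | hx) | hx)
    · obtain ⟨u, hu⟩ := Set.mem_iUnion.1 hx
      exact Set.mem_iUnion.2 ⟨⟨u, u.2.1⟩, hu.1, hu.2.2⟩
    · obtain ⟨u, hu, _, _, _, h, _⟩ := hx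
      exact Set.mem_iUnion.2 ⟨⟨u, hu⟩, h⟩
    · obtain ⟨u, hu⟩ := Set.mem_iUnion.1 hx
      exact Set.mem_iUnion.2 ⟨⟨u, u.2.1⟩, hu⟩
  have dQU : Disjoint EQ (((⋃ u : U1, hang u) ∪ A) ∪ (⋃ u : U2, S.up u)) :=
    (Set.disjoint_iUnion_right.2 fun u : U => (hUEQ u u.2).symm).mono_right hXup
  have eU : U1 ∪ U2 = U := by
    ext x
    constructor
    · rintro (h | h)
      · exact h.1
      · exact h.1
    · intro h
      by_cases hx : ∃ y ∈ A, S.B y x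
      · exact Or.inl ⟨h, hx⟩
      · exact Or.inr ⟨h, hx⟩
  have dD : Disjoint DQ (U1 ∪ U2) := by
    rw [eU, Set.disjoint_left]
    intro x hx hx'
    obtain ⟨q, hq⟩ := Set.mem_iUnion.1 hx
    have := hx'.2 q q.2
    rcases hq with rfl | rfl
    · exact this.1 rfl
    · exact this.2 rfl
  have red := Red.union (S.disj_ed hEQZ (Set.union_subset X1Z U2Z) dQU) dD redQ redU
  have eD : DQ ∪ (U1 ∪ U2) = D := by
    rw [eU]
    ext x
    constructor
    · rintro (hx | hx)
      · obtain ⟨q, hq⟩ := Set.mem_iUnion.1 hx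
        rcases hq with rfl | rfl
        · exact (g1 q q.2).1
        · exact (g1 q q.2).2.1
      · exact hx.1
    · intro hx
      by_cases h : x ∈ U
      · exact Or.inr h
      · left
        simp only [hU, Set.mem_ofPred_eq, not_and, not_forall] at h
        obtain ⟨q, hq, h⟩ := h hx
        refine Set.mem_iUnion.2 ⟨⟨q, hq⟩, ?_⟩
        by_contra h'
        simp only [Set.mem_insert_iff, Set.mem_singleton_iff, not_or] at h'
        exact h h'.1 h'.2
  rw [eD, ← Set.image_union] at red
  refine ⟨_, _, ?_, red.mono (Set.image_mono ?_)⟩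
  · intro i _
    exact S.reach_Z i
  · exact Set.union_subset hEQZ (Set.union_subset X1Z U2Z)

end TJ

namespace TJ
open SimpleGraph
variable {V : Type*}

theorem first_hit {A : Set (Sym2 V)} {P : Set V} {a c : V} (h : Rch A a c) (hc : c ∈ P) :
    ∃ y ∈ P, Rch {e | e ∈ A ∧ ∃ z ∈ e, z ∉ P} a y := by
  induction h using Relation.ReflTransGen.head_induction_on with
  | refl => exact ⟨c, hc, Rch.refl _⟩
  | @head a a' h _ ih =>
    by_cases ha : a ∈ P
    · exact ⟨a, ha, Rch.refl _⟩
    · obtain ⟨y, hy, hr⟩ := ih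
      have h1 : s(a, a') ∈ {e | e ∈ A ∧ ∃ z ∈ e, z ∉ P} := ⟨h, a, by simp, ha⟩
      exact ⟨y, hy, (Rch.single h1).trans hr⟩

theorem cross {A : Set (Sym2 V)} {P : Set V} {a c : V} (h : Rch A a c) (ha : a ∉ P) (hc : c ∈ P) :
    ∃ x y, x ∉ P ∧ y ∈ P ∧ s(x, y) ∈ A := by
  induction h using Relation.ReflTransGen.head_induction_on with
  | refl => exact absurd hc ha
  | @head a a' h _ ih =>
    by_cases ha' : a' ∈ P
    · exact ⟨a, a', ha, ha', h⟩
    · exact ih ha'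

/-- Vertices lying on a trail in `E` between two vertices of `C`. -/
def Ear (G : SimpleGraph V) (C : Set V) (E : Set (Sym2 V)) : Set V :=
  {v | ∃ x ∈ C, ∃ y ∈ C, ∃ w : G.Walk x y, w.IsTrail ∧ (∀ e ∈ w.edges, e ∈ E) ∧ v ∈ w.support}

theorem trail_append {G : SimpleGraph V} {u v w : V} {p : G.Walk u v} {q : G.Walk v w}
    (hp : p.IsTrail) (hq : q.IsTrail) (h : ∀ e ∈ p.edges, e ∉ q.edges) : (p.append q).IsTrail := by
  rw [Walk.isTrail_def, Walk.edges_append, List.nodup_append]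
  exact ⟨hp.edges_nodup, hq.edges_nodup, fun a ha b hb e => h a ha (e ▸ hb)⟩

theorem ear_comb {G : SimpleGraph V} {C : Set V} {E : Set (Sym2 V)} {x y z a b : V}
    (hx : x ∈ C) (hy : y ∈ C) (p1 : G.Walk x z) (p2 : G.Walk b y) (h1 : p1.IsTrail)
    (h2 : p2.IsTrail) (h12 : ∀ e ∈ p1.edges, e ∉ p2.edges) (hE1 : ∀ e ∈ p1.edges, e ∈ E)
    (hE2 : ∀ e ∈ p2.edges, e ∈ E) (M : G.Walk a z) (hM : M.IsTrail)
    (hM' : ∀ e ∈ M.edges, e ∈ E ∧ e ∉ p1.edges ∧ e ∉ p2.edges ∧ e ≠ s(a, b)) (hab : G.Adj a b)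
    (he : s(a, b) ∈ E) (he1 : s(a, b) ∉ p1.edges) (he2 : s(a, b) ∉ p2.edges) : a ∈ Ear G C E := by
  have t2 : (Walk.cons hab p2).IsTrail := by
    rw [Walk.isTrail_cons]; exact ⟨h2, he2⟩
  have t3 : (M.reverse.append (Walk.cons hab p2)).IsTrail := by
    refine trail_append hM.reverse t2 fun e h h' => ?_
    rw [Walk.edges_reverse, List.mem_reverse] at h
    rw [Walk.edges_cons, List.mem_cons] at h'
    rcases h' with h' | h'
    · exact (hM' e h).2.2.2 h'
    · exact (hM' e h).2.2.1 h'
  refine ⟨x, hx, y, hy, p1.append (M.reverse.append (Walk.cons hab p2)), ?_, ?_, ?_⟩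
  · refine trail_append h1 t3 fun e h h' => ?_
    simp only [Walk.edges_append, Walk.edges_reverse, List.mem_append, List.mem_reverse,
      Walk.edges_cons, List.mem_cons] at h'
    rcases h' with h' | rfl | h'
    · exact (hM' e h').2.1 h
    · exact he1 h
    · exact h12 e h h'
  · intro e h'
    simp only [Walk.edges_append, Walk.edges_reverse, List.mem_append, List.mem_reverse,
      Walk.edges_cons, List.mem_cons] at h'
    rcases h' with h' | h' | rfl | h'
    · exact hE1 e h'
    · exact (hM' e h').1
    · exact he
    · exact hE2 e h'
  · simp [Walk.mem_support_append_iff]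

theorem subset_ear {G : SimpleGraph V} {C : Set V} {E : Set (Sym2 V)} : C ⊆ Ear G C E :=
  fun x hx => ⟨x, hx, x, hx, Walk.nil, by simp, by simp, by simp⟩

theorem ear_extend {G : SimpleGraph V} {C : Set V} {E : Set (Sym2 V)} (hE : E ⊆ G.edgeSet)
    {a b c : V} (hb : b ∈ Ear G C E) (he : s(a, b) ∈ E) (ha : a ∉ Ear G C E) (hc : c ∈ C)
    (hr : Rch (E \ {s(a, b)}) a c) : False := by
  classical
  obtain ⟨x, hx, y, hy, w, hw, hwE, hbw⟩ := hb
  have haw : a ∉ w.support := fun h => ha ⟨x, hx, y, hy, w, hw, hwE, h⟩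
  have hew : s(a, b) ∉ w.edges := fun h => haw (Walk.fst_mem_support_of_mem_edges w h)
  obtain ⟨z, hz, hrz⟩ := first_hit (P := {v | v ∈ w.support ∨ v ∈ C}) hr (Or.inr hc)
  obtain ⟨M, hM, hM'⟩ := hrz.exists_path (G := G) fun e he => hE he.1.1
  have hMw : ∀ e ∈ M.edges, e ∉ w.edges := fun e h h' => by
    obtain ⟨-, v, hv, hvP⟩ := hM' e h
    exact hvP (Or.inl (Walk.mem_support_of_mem_edges h' hv))
  have hM1 : ∀ e ∈ M.edges, e ∈ E := fun e h => (hM' e h).1.1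
  have hM2 : ∀ e ∈ M.edges, e ≠ s(a, b) := fun e h => (hM' e h).1.2
  have hts := w.edges_takeUntil_subset_edges hbw
  have hds := w.edges_dropUntil_subset_edges hbw
  have hsp : (w.takeUntil b hbw).edges ++ (w.dropUntil b hbw).edges = w.edges := by
    rw [← Walk.edges_append, Walk.take_spec]
  have hnd := hw.edges_nodup
  rw [← hsp, List.nodup_append] at hnd
  have hdis : ∀ e ∈ (w.takeUntil b hbw).edges, e ∉ (w.dropUntil b hbw).edges := fun e h h' =>
    hnd.2.2 e h e h' rfl
  have hadj : G.Adj a b := hE he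
  by_cases hzC : z ∈ C
  · exact ha (ear_comb hzC hy Walk.nil (w.dropUntil b hbw) (by simp) (hw.dropUntil hbw) (by simp)
      (by simp) (fun e h => hwE e (hds h)) M hM.isTrail (fun e h => ⟨hM1 e h, by simp,
      fun h' => hMw e h (hds h'), hM2 e h⟩) hadj he (by simp) fun h => hew (hds h))
  have hzw : z ∈ w.support := hz.resolve_right hzC
  rw [← Walk.take_spec w hbw, Walk.mem_support_append_iff] at hzw
  rcases hzw with hzw | hzw
  · have hs := (w.takeUntil b hbw).edges_takeUntil_subset_edges hzw
    exact ha (ear_comb hx hy ((w.takeUntil b hbw).takeUntil z hzw) (w.dropUntil b hbw)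
      ((hw.takeUntil hbw).takeUntil hzw) (hw.dropUntil hbw) (fun e h => hdis e (hs h))
      (fun e h => hwE e (hts (hs h))) (fun e h => hwE e (hds h)) M hM.isTrail
      (fun e h => ⟨hM1 e h, fun h' => hMw e h (hts (hs h')),
      fun h' => hMw e h (hds h'), hM2 e h⟩) hadj he (fun h => hew (hts (hs h)))
        fun h => hew (hds h))
  · have hs := (w.dropUntil b hbw).edges_dropUntil_subset_edges hzw
    have hs' : ∀ e ∈ ((w.dropUntil b hbw).dropUntil z hzw).reverse.edges,
        e ∈ (w.dropUntil b hbw).edges := fun e h => hs (by simpa using h)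
    have ht' : ∀ e ∈ (w.takeUntil b hbw).reverse.edges,
        e ∈ (w.takeUntil b hbw).edges := fun e h => (by simpa using h)
    exact ha (ear_comb hy hx ((w.dropUntil b hbw).dropUntil z hzw).reverse
      (w.takeUntil b hbw).reverse
      ((hw.dropUntil hbw).dropUntil hzw).reverse (hw.takeUntil hbw).reverse
      (fun e h h' => hdis e (ht' e h') (hs' e h))
      (fun e h => hwE e (hds (hs' e h))) (fun e h => hwE e (hts (ht' e h))) M hM.isTrail
      (fun e h => ⟨hM1 e h, fun h' => hMw e h (hds (hs' e h')),
      fun h' => hMw e h (hts (ht' e h')), hM2 e h⟩) hadj he (fun h => hew (hds (hs' _ h)))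
        fun h => hew (hts (ht' _ h)))

theorem rch_avoid {A : Set (Sym2 V)} {Y : Set V} {a f : V} {e : Sym2 V} (h : Rch A a f)
    (hY : ∀ v, Rch A a v → v ∉ Y) (he : ∃ b ∈ e, b ∈ Y) : Rch (A \ {e}) a f := by
  induction h with
  | refl => exact Rch.refl _
  | @tail v v' hv hs ih =>
    refine ih.trans (Rch.single ⟨hs, ?_⟩)
    rintro rfl
    obtain ⟨b, hb, hbY⟩ := he
    rcases Sym2.mem_iff.1 hb with rfl | rfl
    · exact hY _ hv hbY
    · exact hY _ (Rch.trans hv (Rch.single hs)) hbY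

theorem rch_connected {G : SimpleGraph V} (h : G.Connected) (a b : V) : Rch G.edgeSet a b := by
  obtain ⟨w⟩ := h.preconnected a b
  exact rch_of_walk w fun e he => w.edges_subset_edgeSet he

/-- There are infinitely many edge-disjoint connections from `T \ C` to `C` avoiding `EC`. -/
def TInf (G : SimpleGraph V) (T C : Set V) (EC : Set (Sym2 V)) : Prop :=
  ∀ F : Set (Sym2 V), F.Finite → ∀ T0 : Set V, T0.Finite →
    ∃ t ∈ T, t ∉ T0 ∧ t ∉ C ∧ ∃ c ∈ C, Rch ((G.edgeSet \ EC) \ F) t c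

theorem ear_exists {G : SimpleGraph V} (hG : G.TwoEdgeConnected) {T C : Set V}
    {EC : Set (Sym2 V)} (hEC : ∀ e ∈ EC, ∀ z ∈ e, z ∈ C) (hinf : TInf G T C EC)
    (F : Set (Sym2 V)) (hF : F.Finite) (T0 : Set V) (hT0 : T0.Finite) :
    ∃ t ∈ T, t ∉ T0 ∧ t ∉ C ∧ t ∈ Ear G C ((G.edgeSet \ EC) \ F) := by
  classical
  by_contra hcon
  push Not at hcon
  set E : Set (Sym2 V) := (G.edgeSet \ EC) \ F with hE
  have hEG : E ⊆ G.edgeSet := fun e h => h.1.1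
  set Y := Ear G C E with hY
  set X : Set V := {v | ∃ g ∈ F, v ∈ g} with hX
  have hXfin : X.Finite := by
    have : X = ⋃ g ∈ F, {v | v ∈ g} := by ext; simp [hX]
    rw [this]
    refine hF.biUnion fun g _ => ?_
    induction g with
    | _ x y => 
      refine (Set.toFinite {x, y}).subset fun v hv => ?_
      simpa using hv
  let Bs : Set (Sym2 V) := {e | e ∈ E ∧ ∃ a b, a ∉ Y ∧ b ∈ Y ∧ e = s(a, b)}
  obtain ⟨-, -, -, -, c0, hc0, -⟩ := hinf ∅ (by simp) ∅ (by simp)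
  have hB : ∀ e : Bs, ∃ a b, ∃ f : X, a ∉ Y ∧ b ∈ Y ∧ e.1 = s(a, b) ∧ Rch (E \ {e.1}) a f := by
    rintro ⟨e, heE, a, b, ha, hb, rfl⟩
    have h1 := rch_connected (hG.2 _ (hEG heE)) a c0
    rw [edgeSet_deleteEdges] at h1
    obtain ⟨y, hy, h2⟩ := first_hit (P := C ∪ X) h1 (Or.inl hc0)
    have h3 : Rch (E \ {s(a, b)}) a y := by
      refine h2.mono ?_
      rintro g ⟨⟨hg1, hg2⟩, z, hz, hzP⟩
      refine ⟨⟨⟨hg1, fun h => hzP (Or.inl (hEC g h z hz))⟩, fun h => hzP (Or.inr ⟨g, h, hz⟩)⟩, hg2⟩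
    rcases hy with hy | hy
    · exact (ear_extend hEG hb heE ha hy h3).elim
    · exact ⟨a, b, ⟨y, hy⟩, ha, hb, rfl, h3⟩
  choose a b f ha hb hab hr using hB
  have N : ∀ e : Bs, ∀ v, Rch (E \ {e.1}) (a e) v → v ∉ Y := by
    rintro e v hv ⟨x, hx, y, hy, w, hw, hwE, hvw⟩
    have hew : e.1 ∉ w.edges := fun h => ha e ⟨x, hx, y, hy, w, hw, hwE, by
      rw [hab e] at h
      exact Walk.fst_mem_support_of_mem_edges w h⟩
    have hvx : Rch (E \ {e.1}) v y := rch_of_walk (w.dropUntil v hvw) fun g hg => by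
      have hg' := w.edges_dropUntil_subset_edges hvw hg
      refine ⟨hwE g hg', ?_⟩
      rintro rfl
      exact hew hg'
    have h5 := hv.trans hvx
    have heE := e.2.1
    rw [hab e] at h5 heE
    exact ear_extend hEG (hb e) heE (ha e) hy h5
  have finj : Function.Injective f := by
    intro e e' hf
    by_contra hne
    have hne' : e'.1 ≠ e.1 := fun h => hne (Subtype.ext h.symm)
    have h1 : Rch ((E \ {e'.1}) \ {e.1}) (a e') (f e') :=
      rch_avoid (hr e') (N e') ⟨b e, by rw [hab e]; simp, hb e⟩
    have h2 : Rch (E \ {e.1}) (a e') (f e') := by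
      refine h1.mono ?_
      rintro g ⟨h5, h6⟩
      exact ⟨h5.1, h6⟩
    rw [← hf] at h2
    have h3 := (hr e).trans h2.symm
    have h4 : s(a e', b e') ∈ E \ {e.1} := by
      rw [← hab e']; exact ⟨e'.2.1, hne'⟩
    exact N e _ (h3.trans (Rch.single h4)) (hb e')
  have : Finite X := hXfin.to_subtype
  have hBfin : Bs.Finite := Set.finite_coe_iff.1 (Finite.of_injective f finj)
  obtain ⟨t, htT, ht0, htC, c, hc, htc⟩ := hinf (F ∪ Bs) (hF.union hBfin) T0 hT0
  obtain ⟨x, y, hx, hy, hxy⟩ := cross htc (hcon t htT ht0 htC) (subset_ear hc)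
  have hxE : s(x, y) ∈ E := ⟨hxy.1, fun h => hxy.2 (Or.inl h)⟩
  exact hxy.2 (Or.inr ⟨hxE, x, y, hx, hy, rfl⟩)

/-- A sequence of pairwise edge-disjoint ears with distinct marked vertices in `T \ C`. -/
theorem ear_seq {G : SimpleGraph V} (hG : G.TwoEdgeConnected) {T C : Set V}
    {EC : Set (Sym2 V)} (hEC : ∀ e ∈ EC, ∀ z ∈ e, z ∈ C) (hinf : TInf G T C EC) :
    ∃ (x y t : ℕ → V) (w : ∀ k, G.Walk (x k) (y k)), (∀ k, x k ∈ C) ∧ (∀ k, y k ∈ C) ∧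
      (∀ k, t k ∈ T ∧ t k ∉ C) ∧ (∀ k, t k ∈ (w k).support) ∧ (∀ k, (w k).IsTrail) ∧
      (∀ k, ∀ e ∈ (w k).edges, e ∉ EC) ∧ Function.Injective t ∧
      ∀ k l, k ≠ l → ∀ e ∈ (w k).edges, e ∉ (w l).edges := by
  classical
  let α := (Σ x : V, Σ y : V, G.Walk x y) × V
  let P : α → Prop := fun q => q.1.1 ∈ C ∧ q.1.2.1 ∈ C ∧ (q.2 ∈ T ∧ q.2 ∉ C) ∧
    q.2 ∈ q.1.2.2.support ∧ q.1.2.2.IsTrail ∧ ∀ e ∈ q.1.2.2.edges, e ∉ EC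
  let r : α → α → Prop := fun q q' => q.2 ≠ q'.2 ∧ (∀ e ∈ q.1.2.2.edges, e ∉ q'.1.2.2.edges)
  have : Std.Symm r := ⟨fun q q' h => ⟨h.1.symm, fun e he he' => h.2 e he' he⟩⟩
  obtain ⟨f, hf1, hf2⟩ := exists_seq_of_forall_finset_exists' P r fun s _ => by
    have h1 : (⋃ q ∈ s, {e | e ∈ q.1.2.2.edges}).Finite :=
      s.finite_toSet.biUnion fun q _ => List.finite_toSet _
    have h2 : ((fun q : α => q.2) '' (s : Set α)).Finite := s.finite_toSet.image _
    obtain ⟨t, ht, ht0, htC, x, hx, y, hy, w, hw, hwE, htw⟩ := ear_exists hG hEC hinf _ h1 _ h2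
    refine ⟨(⟨x, y, w⟩, t), ⟨hx, hy, ⟨ht, htC⟩, htw, hw, fun e he => (hwE e he).1.2⟩, ?_⟩
    intro q hq
    refine ⟨fun h => ht0 ⟨q, hq, h⟩, fun e he he' => (hwE e he').2 ?_⟩
    exact Set.mem_biUnion (show q ∈ (s : Set α) from hq) he
  refine ⟨fun k => (f k).1.1, fun k => (f k).1.2.1, fun k => (f k).2, fun k => (f k).1.2.2,
    fun k => (hf1 k).1, fun k => (hf1 k).2.1, fun k => (hf1 k).2.2.1, fun k => (hf1 k).2.2.2.1,
    fun k => (hf1 k).2.2.2.2.1, fun k => (hf1 k).2.2.2.2.2, ?_, ?_⟩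
  · intro k l h
    by_contra hne
    exact (hf2 hne).1 h
  · intro k l h
    exact (hf2 h).2

end TJ

namespace TJ
open SimpleGraph
variable {V : Type*}

theorem assemble {κ : Type*} {G : SimpleGraph V} (hG : G.Connected) (T C : Set V)
    (hC : C.Nonempty) {EC : Set (Sym2 V)} (hEC : ∀ e ∈ EC, ∀ z ∈ e, z ∈ C)
    (x y t : κ → V) (w : ∀ k, G.Walk (x k) (y k)) (hx : ∀ k, x k ∈ C) (hy : ∀ k, y k ∈ C)
    (ht : ∀ k, t k ∈ T ∧ t k ∉ C) (htw : ∀ k, t k ∈ (w k).support) (hw : ∀ k, (w k).IsTrail)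
    (hwE : ∀ k, ∀ e ∈ (w k).edges, e ∉ EC) (hti : Function.Injective t)
    (hdisj : ∀ k l, k ≠ l → ∀ e ∈ (w k).edges, e ∉ (w l).edges) :
    ∃ (D3 : Set V) (p3 : V → V), Red (G.edgeSet \ EC) T (fun v => v) D3 p3 ∧
      (∀ i ∈ D3, p3 i ∈ C) ∧ T ∩ C ⊆ D3 ∧ (Infinite κ → D3.Infinite) ∧
      ∀ v, {k | x k = v ∨ y k = v}.Finite → {i | i ∈ D3 ∧ p3 i = v}.Finite := by
  classical
  let Z : Set V := C ∪ ⋃ k, {v | v ∈ (w k).support}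
  have hCZ : C ⊆ Z := Set.subset_union_left
  have hwZ : ∀ k, ∀ v ∈ (w k).support, v ∈ Z := fun k v hv => Or.inr (Set.mem_iUnion.2 ⟨k, hv⟩)
  obtain ⟨S⟩ := exists_frst G hG (hC.mono hCZ)
  obtain ⟨D1, p1, hD1, r1⟩ := claimA S (T \ Z) fun v hv => hv.2
  obtain ⟨D2, hD2, r2⟩ := pairing_all D1 p1
  have D2D1 := r2.subset
  have D2T : D2 ⊆ T \ Z := D2D1.trans r1.subset
  obtain ⟨q, hq1, hq2⟩ : ∃ q : V → V, (∀ i ∈ Z, q i = i) ∧ ∀ i ∉ Z, q i = p1 i :=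
    ⟨fun i => if i ∈ Z then i else p1 i, fun i hi => by simp [hi], fun i hi => by simp [hi]⟩
  have r3 : Red (S.ed '' Zᶜ) T (fun v => v) (D2 ∪ T ∩ Z) q := by
    have h1 := (Red.comp (by simp) r1 r2).congr (q' := q) (fun _ _ => rfl)
      (fun i hi => (hq2 i (D2T hi).2).symm)
    have h2 : Red (∅ : Set (Sym2 V)) (T ∩ Z) (fun v => v) (T ∩ Z) q :=
      (Red.id (p := fun v => v)).congr (fun _ _ => rfl) fun i hi => (hq1 i hi.2).symm
    have h3 := Red.union (by simp) Set.disjoint_sdiff_inter h1 h2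
    rw [Set.sdiff_union_inter] at h3
    exact h3.mono (by simp)
  set Dq : Set V := D2 ∪ T ∩ Z with hDq
  have hqZ : ∀ i ∈ Dq, q i ∈ Z := by
    rintro i (hi | hi)
    · rw [hq2 i (D2T hi).2]; exact hD1 i (D2D1 hi)
    · rw [hq1 i hi.2]; exact hi.2
  have hfib : ∀ v, {i | i ∈ Dq ∧ q i = v}.Finite := fun v => by
    have h1 : {i | i ∈ D2 ∧ p1 i = v}.Subsingleton := fun i hi j hj =>
      hD2 hi.1 hj.1 (hi.2.trans hj.2.symm)
    refine (h1.finite.union (Set.finite_singleton v)).subset ?_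
    rintro i ⟨hi | hi, hv⟩
    · left; exact ⟨hi, by rw [← hq2 i (D2T hi).2, hv]⟩
    · right; rw [hq1 i hi.2] at hv; exact hv
  let R : Set V := {i | i ∈ Dq ∧ q i ∉ C}
  have hg : ∀ i : R, ∃ k, q i ∈ (w k).support ∧ ∀ l, t l = i → l = k := by
    rintro ⟨i, hi, hiC⟩
    by_cases h : ∃ k, t k = i
    · obtain ⟨k, rfl⟩ := h
      refine ⟨k, ?_, fun l hl => hti hl⟩
      change q (t k) ∈ _
      rw [hq1 _ (hwZ k _ (htw k))]
      exact htw k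
    · rcases hqZ i hi with h' | h'
      · exact absurd h' hiC
      · obtain ⟨k, hk⟩ := Set.mem_iUnion.1 h'
        exact ⟨k, hk, fun l hl => absurd ⟨l, hl⟩ h⟩
  choose g hg1 hg2 using hg
  let Dk : κ → Set V := fun k => {i | ∃ h : i ∈ R, g ⟨i, h⟩ = k}
  have htD : ∀ k, t k ∈ Dk k := fun k => by
    have hz := hwZ k _ (htw k)
    have h : t k ∈ R := ⟨Or.inr ⟨(ht k).1, hz⟩, by rw [hq1 _ hz]; exact (ht k).2⟩
    exact ⟨h, (hg2 ⟨_, h⟩ k rfl).symm⟩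
  have hDd : Pairwise fun k l => Disjoint (Dk k) (Dk l) := by
    intro k l hkl
    rw [Set.disjoint_left]
    rintro i ⟨h, rfl⟩ ⟨_, h'⟩
    exact hkl h'
  have hDR : (⋃ k, Dk k) = R := by
    ext i
    constructor
    · intro h
      obtain ⟨k, h, _⟩ := Set.mem_iUnion.1 h
      exact h
    · intro h
      exact Set.mem_iUnion.2 ⟨_, h, rfl⟩
  have htt : ∀ k, ∃ i₀, ∃ D' : Set V, D'.Subsingleton ∧ i₀ ∉ D' ∧ ∃ p' : V → V, p' i₀ = x k ∧
      (∀ i ∈ D', p' i = y k) ∧ Red {e | e ∈ (w k).edges} (Dk k) q ({i₀} ∪ D') p' := fun k =>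
    trail_two (w k) (hw k) (Dk k) q (by rintro i ⟨h, rfl⟩; exact hg1 _) ⟨_, htD k⟩
  choose i0 D' hD's _ pk hpk1 hpk2 hred using htt
  obtain ⟨q2, hq2k, r4⟩ := Red.par (fun k => {e | e ∈ (w k).edges}) Dk
    (fun k => {i0 k} ∪ D' k) q pk (fun k l hkl => Set.disjoint_left.2 (hdisj k l hkl)) hDd hred
  rw [hDR] at r4
  have hsub : ∀ k, {i0 k} ∪ D' k ⊆ Dk k := fun k => (hred k).subset
  have hDkR : ∀ k, Dk k ⊆ R := fun k i hi => hi.1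
  obtain ⟨p3, hp1, hp2⟩ : ∃ p3 : V → V, (∀ i ∈ R, p3 i = q2 i) ∧ ∀ i ∉ R, p3 i = q i :=
    ⟨fun i => if i ∈ R then q2 i else q i, fun i hi => by simp [hi], fun i hi => by simp [hi]⟩
  let Cq : Set V := {i | i ∈ Dq ∧ q i ∈ C}
  have hCR : ∀ i ∈ Cq, i ∉ R := fun i hi h => h.2 hi.2
  have hun : R ∪ Cq = Dq := by
    ext i
    constructor
    · rintro (h | h)
      · exact h.1
      · exact h.1
    · intro h
      by_cases h' : q i ∈ C
      · exact Or.inr ⟨h, h'⟩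
      · exact Or.inl ⟨h, h'⟩
  have r5 : Red (⋃ k, {e | e ∈ (w k).edges}) Dq q ((⋃ k, ({i0 k} ∪ D' k)) ∪ Cq) p3 := by
    have h1 := r4.congr (q' := p3) (fun _ _ => rfl)
      (fun i hi => (hp1 i (r4.subset hi)).symm)
    have h2 : Red (∅ : Set (Sym2 V)) Cq q Cq p3 :=
      (Red.id (p := q)).congr (fun _ _ => rfl) fun i hi => (hp2 i (hCR i hi)).symm
    have h3 := Red.union (by simp) (Set.disjoint_right.2 hCR) h1 h2
    rw [hun] at h3
    exact h3.mono (by simp)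
  have hE : Disjoint (S.ed '' Zᶜ) (⋃ k, {e | e ∈ (w k).edges}) := by
    rw [Set.disjoint_left]
    rintro _ ⟨v, hv, rfl⟩ h
    obtain ⟨k, hk⟩ := Set.mem_iUnion.1 h
    exact hv (hwZ k v (Walk.fst_mem_support_of_mem_edges _ hk))
  have r6 := Red.comp hE r3 r5
  have hpos : ∀ k, p3 (i0 k) = x k ∧ ∀ i ∈ D' k, p3 i = y k := fun k => by
    have h0 := hsub k (Or.inl rfl)
    refine ⟨by rw [hp1 _ (hDkR k h0), hq2k k _ h0, hpk1], fun i hi => ?_⟩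
    have h0 := hsub k (Or.inr hi)
    rw [hp1 _ (hDkR k h0), hq2k k _ h0, hpk2 k i hi]
  refine ⟨(⋃ k, ({i0 k} ∪ D' k)) ∪ Cq, p3, r6.mono ?_, ?_, ?_, ?_, ?_⟩
  · rintro e (⟨v, hv, rfl⟩ | h)
    · exact ⟨S.ed_mem hv, fun h => hv (hCZ (hEC _ h v (by simp [Frst.ed])))⟩
    · obtain ⟨k, hk⟩ := Set.mem_iUnion.1 h
      exact ⟨(w k).edges_subset_edgeSet hk, hwE k e hk⟩
  · rintro i (h | h)
    · obtain ⟨k, rfl | hk⟩ := Set.mem_iUnion.1 h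
      · rw [(hpos k).1]; exact hx k
      · rw [(hpos k).2 i hk]; exact hy k
    · rw [hp2 i (hCR i h)]; exact h.2
  · rintro i ⟨hiT, hiC⟩
    right
    exact ⟨Or.inr ⟨hiT, hCZ hiC⟩, by rw [hq1 i (hCZ hiC)]; exact hiC⟩
  · intro hκ
    have hinj : Function.Injective i0 := by
      intro k l h
      by_contra hne
      refine Set.disjoint_left.1 (hDd hne) (hsub k (Or.inl rfl)) ?_
      rw [h]
      exact hsub l (Or.inl rfl)
    refine (Set.infinite_range_of_injective hinj).mono ?_
    rintro _ ⟨k, rfl⟩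
    exact Or.inl (Set.mem_iUnion.2 ⟨k, Or.inl rfl⟩)
  · intro v hv
    refine ((hfib v).union (hv.biUnion (t := fun k => {i0 k} ∪ D' k) fun k _ =>
      (Set.finite_singleton _).union (hD's k).finite)).subset ?_
    rintro i ⟨h | h, hiv⟩
    · right
      obtain ⟨k, hk⟩ := Set.mem_iUnion.1 h
      refine Set.mem_biUnion (x := k) ?_ hk
      rcases hk with rfl | hk
      · left; rw [← (hpos k).1, hiv]
      · right; rw [← (hpos k).2 i hk, hiv]
    · left
      exact ⟨h.1, by rw [← hp2 i (hCR i h), hiv]⟩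

end TJ

namespace TJ
open SimpleGraph
variable {V : Type*} {ι : Type*}

theorem exists_enum (D : Set ι) (hD : D.Infinite) (pos : ι → ℕ)
    (hfib : ∀ n, {i | i ∈ D ∧ pos i = n}.Finite) :
    ∃ e : ℕ → ι, Function.Injective e ∧ Set.range e = D ∧ Monotone fun k => pos (e k) := by
  classical
  let _ : LinearOrder ι := linearOrderOfSTO WellOrderingRel
  let lt : ι → ι → Prop := fun j i => pos j < pos i ∨ pos j = pos i ∧ j < i
  have htrans : ∀ a b c, lt a b → lt b c → lt a c := by
    rintro a b c (h | h) (h' | h')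
    · left; omega
    · left; omega
    · left; omega
    · right; exact ⟨by omega, h.2.trans h'.2⟩
  have hirr : ∀ a, ¬ lt a a := by
    rintro a (h | h)
    · omega
    · exact lt_irrefl _ h.2
  have htot : ∀ a b, a ≠ b → lt a b ∨ lt b a := by
    intro a b hab
    rcases lt_trichotomy (pos a) (pos b) with h | h | h
    · exact Or.inl (Or.inl h)
    · rcases lt_or_gt_of_ne hab with h' | h'
      · exact Or.inl (Or.inr ⟨h, h'⟩)
      · exact Or.inr (Or.inr ⟨h.symm, h'⟩)
    · exact Or.inr (Or.inl h)
  let I : ι → Set ι := fun i => {j | j ∈ D ∧ lt j i}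
  have hI : ∀ i, (I i).Finite := fun i => by
    refine ((Set.finite_Iic (pos i)).biUnion (t := fun n => {j | j ∈ D ∧ pos j = n})
      fun n _ => hfib n).subset ?_
    rintro j ⟨hj, h⟩
    refine Set.mem_biUnion (x := pos j) ?_ ⟨hj, rfl⟩
    rcases h with h | h
    · exact h.le
    · exact h.1.le
  let f : ι → ℕ := fun i => (I i).ncard
  have hf : ∀ i ∈ D, ∀ j, lt i j → f i < f j := fun i hi j h => by
    refine Set.ncard_lt_ncard ⟨?_, ?_⟩ (hI j)
    · rintro l ⟨hl, h'⟩
      exact ⟨hl, htrans _ _ _ h' h⟩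
    · intro hh
      exact hirr i (hh ⟨hi, h⟩).2
  have hinj : Set.InjOn f D := by
    intro i hi j hj hij
    by_contra hne
    rcases htot i j hne with h | h
    · exact absurd (hf i hi j h) (by omega)
    · exact absurd (hf j hj i h) (by omega)
  have : Infinite (f '' D) := (hD.image hinj).to_subtype
  let o := Nat.Subtype.orderIsoOfNat (f '' D)
  have ho : ∀ k, ∃ i, i ∈ D ∧ f i = o k := fun k => (o k).2
  choose e he1 he2 using ho
  refine ⟨e, ?_, ?_, ?_⟩
  · intro k l h
    have : (o k : ℕ) = o l := by rw [← he2, ← he2, h]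
    exact o.injective (Subtype.ext this)
  · ext i
    constructor
    · rintro ⟨k, rfl⟩; exact he1 k
    · intro hi
      obtain ⟨k, hk⟩ := o.surjective ⟨f i, i, hi, rfl⟩
      refine ⟨k, hinj (he1 k) hi ?_⟩
      rw [he2, hk]
  · intro k l hkl
    by_contra h
    have h1 : f (e l) < f (e k) := hf _ (he1 l) _ (Or.inl (not_le.1 h))
    rw [he2, he2] at h1
    have : o k ≤ o l := o.monotone hkl
    exact absurd (show (o k : ℕ) ≤ o l from this) (by omega)

theorem ray_pair {v : ℕ → V} (hv : ∀ m n, s(v m, v (m + 1)) = s(v n, v (n + 1)) → m = n)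
    (D : Set ι) (hD : D.Infinite) (pos : ι → ℕ) (p p' : ι → V) (hp : ∀ i ∈ D, p i = v (pos i))
    (hfib : ∀ n, {i | i ∈ D ∧ pos i = n}.Finite) :
    Red {e | ∃ n, e = s(v n, v (n + 1))} D p ∅ p' := by
  obtain ⟨e, hinj, hr, hm⟩ := exists_enum D hD pos hfib
  have heD : ∀ k, e k ∈ D := fun k => by rw [← hr]; exact ⟨k, rfl⟩
  have := Red.par' (fun k : ℕ => {g | ∃ n, pos (e (2 * k)) ≤ n ∧ n < pos (e (2 * k + 1)) ∧
    g = s(v n, v (n + 1))}) (fun k => {e (2 * k), e (2 * k + 1)}) (fun _ => ∅) p p' ?_ ?_ ?_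
  · have e1 : (⋃ k, {e (2 * k), e (2 * k + 1)}) = D := by
      rw [← hr]
      ext i
      simp only [Set.mem_iUnion, Set.mem_insert_iff, Set.mem_singleton_iff, Set.mem_range]
      constructor
      · rintro ⟨k, rfl | rfl⟩
        · exact ⟨_, rfl⟩
        · exact ⟨_, rfl⟩
      · rintro ⟨k, rfl⟩
        rcases Nat.even_or_odd' k with ⟨l, rfl | rfl⟩
        · exact ⟨l, Or.inl rfl⟩
        · exact ⟨l, Or.inr rfl⟩
    rw [e1, Set.iUnion_empty] at this
    refine this.mono (Set.iUnion_subset fun k => ?_)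
    rintro g ⟨n, -, -, h⟩
    exact ⟨n, h⟩
  · have aux : ∀ k l : ℕ, k < l → pos (e (2 * k + 1)) ≤ pos (e (2 * l)) := fun k l h =>
      hm (show 2 * k + 1 ≤ 2 * l by omega)
    intro k l hkl
    rw [Set.disjoint_left]
    rintro g ⟨n, h1, h2, rfl⟩ ⟨m, h3, h4, h5⟩
    obtain rfl := hv _ _ h5
    rcases lt_or_gt_of_ne hkl with h | h
    · have := aux k l h; omega
    · have := aux l k h; omega
  · intro k l hkl
    rw [Set.disjoint_left]
    rintro i (rfl | rfl) (h | h) <;> · have := hinj h; omega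
  · intro k
    refine Red.pair (fun h => by have := hinj h; omega) ?_
    rw [hp _ (heD _), hp _ (heD _)]
    have key : ∀ a b, a ≤ b → Rch {g | ∃ n, a ≤ n ∧ n < b ∧ g = s(v n, v (n + 1))} (v a) (v b) := by
      intro a b hab
      induction b, hab using Nat.le_induction with
      | base => exact Rch.refl _
      | succ b hab ih =>
        refine (ih.mono ?_).trans (Rch.single ⟨b, hab, by omega, rfl⟩)
        rintro g ⟨n, h1, h2, h3⟩
        exact ⟨n, h1, by omega, h3⟩
    exact key _ _ (hm (by omega))

end TJ

namespace TJ
open SimpleGraph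
variable {V : Type*}

theorem fin_ends {F : Set (Sym2 V)} (hF : F.Finite) : {v | ∃ g ∈ F, v ∈ g}.Finite := by
  have : {v | ∃ g ∈ F, v ∈ g} = ⋃ g ∈ F, {v | v ∈ g} := by ext; simp
  rw [this]
  refine hF.biUnion fun g _ => ?_
  induction g with
  | _ x y =>
    refine (Set.toFinite {x, y}).subset fun v hv => ?_
    simpa using hv

theorem case_vertex {G : SimpleGraph V} (hG : G.TwoEdgeConnected) {T : Set V} {c : V}
    (h : TInf G T {c} ∅) : G.HasTJoin T := by
  obtain ⟨x, y, t, w, hx, hy, ht, htw, hw, hwE, hti, hdisj⟩ := ear_seq hG (by simp) h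
  obtain ⟨D3, p3, r, hp, -, hinf, -⟩ := assemble hG.1 T {c} ⟨c, rfl⟩ (by simp) x y t w hx hy ht htw
    hw hwE hti hdisj
  have r2 : Red (∅ : Set (Sym2 V)) D3 p3 ∅ p3 := pairing_inf (hinf inferInstance) fun i hi j hj =>
    (hp i hi).trans (hp j hj).symm
  exact hasTJoin_of_red ((Red.comp (by simp) r r2).mono (by simp))

theorem child {G : SimpleGraph V} {T Z : Set V} (S : Frst G Z)
    (h : ∀ c, ¬ TInf G T {c} ∅) (u : V) (hu : {t | t ∈ T ∧ S.B u t}.Infinite) :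
    ∃ u', u' ∉ Z ∧ S.par u' = u ∧ {t | t ∈ T ∧ S.B u' t}.Infinite := by
  classical
  by_contra hcon
  push Not at hcon
  refine h u fun F hF T0 hT0 => ?_
  set X : Set V := {v | ∃ g ∈ F, v ∈ g} with hX
  have hXf : X.Finite := fin_ends hF
  have hone : ∀ x, {c | c ∉ Z ∧ S.par c = u ∧ S.B c x}.Subsingleton := by
    rintro x c ⟨h1, h2, h3⟩ c' ⟨h1', h2', h3'⟩
    have e1 := S.dep c h1
    have e2 := S.dep c' h1'
    rw [h2] at e1
    rw [h2'] at e2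
    by_contra hne
    rcases S.B_total h3 h3' with hb | hb
    · have := S.B_lt hb h1 hne; omega
    · have := S.B_lt hb h1' (Ne.symm hne); omega
  let bad : Set V := ⋃ x ∈ X, ⋃ c ∈ {c | c ∉ Z ∧ S.par c = u ∧ S.B c x}, {t | t ∈ T ∧ S.B c t}
  have hbad : bad.Finite := hXf.biUnion fun x _ => (hone x).finite.biUnion fun c hc =>
    hcon c hc.1 hc.2.1
  obtain ⟨t, ⟨htT, htB⟩, ht⟩ := hu.exists_notMem_finite ((hT0.union hbad).union (Set.finite_singleton u))
  simp only [Set.mem_union, not_or] at ht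
  obtain ⟨⟨ht0, htb⟩, htu⟩ := ht
  refine ⟨t, htT, ht0, htu, u, rfl, ?_⟩
  let n := Nat.find htB
  have hn : S.par^[n] t = u := Nat.find_spec htB
  have hmin : ∀ i < n, S.par^[i] t ≠ u := fun i hi => Nat.find_min htB hi
  have hZ : ∀ i < n, S.par^[i] t ∉ Z := fun i hi hz => by
    refine hmin i hi ?_
    rw [← hn, ← Nat.sub_add_cancel hi.le, Function.iterate_add_apply, S.iter_Z hz]
  obtain ⟨m, hm⟩ : ∃ m, n = m + 1 := by
    rcases Nat.exists_eq_add_one_of_ne_zero (n := n) (fun h0 => htu (by rw [← hn, h0]; rfl)) with ⟨m, hm⟩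
    exact ⟨m, hm⟩
  let c := S.par^[m] t
  have hcZ : c ∉ Z := hZ m (by omega)
  have hcu : S.par c = u := by rw [← hn, hm, Function.iterate_succ_apply']
  have hct : S.B c t := ⟨m, rfl⟩
  have hr : Rch (S.ed '' {x | x ∉ Z ∧ S.B c x}) t (S.par^[n] t) := S.reach fun i hi hz =>
    ⟨hz, m - i, by rw [← Function.iterate_add_apply, Nat.sub_add_cancel (by omega)]⟩
  rw [hn] at hr
  refine hr.mono ?_
  rintro _ ⟨x, ⟨hxZ, hxc⟩, rfl⟩
  refine ⟨⟨S.ed_mem hxZ, by simp⟩, fun hF' => htb ?_⟩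
  exact Set.mem_biUnion (x := x) ⟨_, hF', by simp [Frst.ed]⟩
    (Set.mem_biUnion (x := c) ⟨hcZ, hcu, hxc⟩ ⟨htT, hct⟩)

theorem finish_ray {κ : Type*} {G : SimpleGraph V} (hG : G.Connected) (T : Set V) {v : ℕ → V}
    (hv : ∀ m n, s(v m, v (m + 1)) = s(v n, v (n + 1)) → m = n)
    (hvG : ∀ n, s(v n, v (n + 1)) ∈ G.edgeSet)
    (x y t : κ → V) (w : ∀ k, G.Walk (x k) (y k)) (hx : ∀ k, x k ∈ Set.range v)
    (hy : ∀ k, y k ∈ Set.range v)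
    (ht : ∀ k, t k ∈ T ∧ t k ∉ Set.range v) (htw : ∀ k, t k ∈ (w k).support)
    (hw : ∀ k, (w k).IsTrail)
    (hwE : ∀ k, ∀ e ∈ (w k).edges, e ∉ {e | ∃ n, e = s(v n, v (n + 1))})
    (hti : Function.Injective t)
    (hdisj : ∀ k l, k ≠ l → ∀ e ∈ (w k).edges, e ∉ (w l).edges)
    (hfin : ∀ u, {k | x k = u ∨ y k = u}.Finite)
    (hinf : Infinite κ ∨ (T ∩ Set.range v).Infinite) : G.HasTJoin T := by
  obtain ⟨D3, p3, r, hp, hsub, hinf3, hf⟩ := assemble hG T (Set.range v) ⟨v 0, 0, rfl⟩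
    (EC := {e | ∃ n, e = s(v n, v (n + 1))}) (by
      rintro e ⟨n, rfl⟩ z hz
      rcases Sym2.mem_iff.1 hz with rfl | rfl
      · exact ⟨_, rfl⟩
      · exact ⟨_, rfl⟩) x y t w hx hy ht htw hw hwE hti hdisj
  have hD3 : D3.Infinite := by
    rcases hinf with h | h
    · exact hinf3 h
    · exact h.mono hsub
  obtain ⟨pos, hpos⟩ : ∃ pos : V → ℕ, ∀ i ∈ D3, p3 i = v (pos i) := by
    have : ∀ i, ∃ n, i ∈ D3 → p3 i = v n := fun i => by
      by_cases hi : i ∈ D3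
      · obtain ⟨n, hn⟩ := hp i hi
        exact ⟨n, fun _ => hn.symm⟩
      · exact ⟨0, fun h => absurd h hi⟩
    choose pos hpos using this
    exact ⟨pos, hpos⟩
  have r2 := ray_pair hv D3 hD3 pos p3 p3 hpos fun n => (hf (v n) (hfin _)).subset (by
    rintro i ⟨hi, rfl⟩
    exact ⟨hi, hpos i hi⟩)
  refine hasTJoin_of_red ((Red.comp Set.disjoint_sdiff_left r r2).mono ?_)
  rintro e (h | ⟨n, rfl⟩)
  · exact h.1
  · exact hvG n

theorem main {G : SimpleGraph V} (hG : G.TwoEdgeConnected) {T : Set V} (hT : T.Infinite) :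
    G.HasTJoin T := by
  classical
  by_cases hc : ∃ c, TInf G T {c} ∅
  · obtain ⟨c, hc⟩ := hc
    exact case_vertex hG hc
  push Not at hc
  obtain ⟨r, -⟩ := hT.nonempty
  obtain ⟨S⟩ := exists_frst G hG.1 (Set.singleton_nonempty r)
  have hr : {t | t ∈ T ∧ S.B r t}.Infinite := hT.mono fun t ht => ⟨ht, S.d t, S.reach_Z t⟩
  have hch := child S hc
  choose nx hnx1 hnx2 hnx3 using hch
  let step : {u // {t | t ∈ T ∧ S.B u t}.Infinite} → {u // {t | t ∈ T ∧ S.B u t}.Infinite} :=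
    fun u => ⟨nx u.1 u.2, hnx3 u.1 u.2⟩
  let vv : ℕ → {u // {t | t ∈ T ∧ S.B u t}.Infinite} := fun n => step^[n] ⟨r, hr⟩
  have hvv : ∀ n, vv (n + 1) = step (vv n) := fun n => Function.iterate_succ_apply' _ _ _
  obtain ⟨v, hv0, hvZ, hvpar, hvinf⟩ : ∃ v : ℕ → V, v 0 = r ∧ (∀ n, v (n + 1) ∉ ({r} : Set V)) ∧
      (∀ n, S.par (v (n + 1)) = v n) ∧ ∀ n, {t | t ∈ T ∧ S.B (v n) t}.Infinite := by
    refine ⟨fun n => (vv n).1, rfl, fun n => ?_, fun n => ?_, fun n => (vv n).2⟩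
    · beta_reduce; rw [hvv]; exact hnx1 _ _
    · beta_reduce; rw [hvv]; exact hnx2 _ _
  have hvd : ∀ n, S.d (v n) = n := by
    intro n
    induction n with
    | zero => rw [hv0]; exact S.dz r rfl
    | succ n ih => rw [S.dep _ (hvZ n), hvpar, ih]
  have hed : ∀ n, s(v n, v (n + 1)) = S.ed (v (n + 1)) := fun n => by
    rw [Frst.ed, hvpar, Sym2.eq_swap]
  have hvE : ∀ m n, s(v m, v (m + 1)) = s(v n, v (n + 1)) → m = n := fun m n h => by
    rw [hed, hed] at h
    have h1 := S.ed_inj (hvZ m) (hvZ n) h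
    have h2 := hvd (m + 1)
    rw [h1, hvd] at h2
    omega
  have hvG : ∀ n, s(v n, v (n + 1)) ∈ G.edgeSet := fun n => by rw [hed]; exact S.ed_mem (hvZ n)
  by_cases hTC : (T ∩ Set.range v).Infinite
  · exact finish_ray (κ := Empty) hG.1 T hvE hvG Empty.elim Empty.elim Empty.elim
      (fun k => k.elim) (fun k => k.elim) (fun k => k.elim) (fun k => k.elim) (fun k => k.elim)
      (fun k => k.elim) (fun k => k.elim) (fun k => k.elim) (fun k => k.elim)
      (fun u => Set.toFinite _) (Or.inr hTC)
  rw [Set.not_infinite] at hTC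
  let EC : Set (Sym2 V) := {e | ∃ n, e = s(v n, v (n + 1))}
  have hEC : ∀ e ∈ EC, ∀ z ∈ e, z ∈ Set.range v := by
    rintro e ⟨n, rfl⟩ z hz
    rcases Sym2.mem_iff.1 hz with rfl | rfl
    · exact ⟨_, rfl⟩
    · exact ⟨_, rfl⟩
  have htinf : TInf G T (Set.range v) EC := by
    intro F hF T0 hT0
    have hXf := fin_ends hF
    obtain ⟨N, hN⟩ := (hXf.image S.d).bddAbove
    obtain ⟨t, ⟨htT, htB⟩, ht⟩ := (hvinf (N + 1)).exists_notMem_finite (hT0.union hTC)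
    simp only [Set.mem_union, not_or] at ht
    refine ⟨t, htT, ht.1, fun h => ht.2 ⟨htT, h⟩, ?_⟩
    obtain ⟨m0, hm0⟩ := htB
    have hex : ∃ m, S.par^[m] t ∈ Set.range v := ⟨m0, N + 1, hm0.symm⟩
    let m := Nat.find hex
    have hmm : m ≤ m0 := Nat.find_min' hex ⟨N + 1, hm0.symm⟩
    refine ⟨S.par^[m] t, Nat.find_spec hex, ?_⟩
    have hr : Rch (S.ed '' {x | x ∉ ({r} : Set V) ∧ x ∉ Set.range v ∧ S.B (v (N + 1)) x}) t
        (S.par^[m] t) := S.reach fun i hi hz =>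
      ⟨hz, Nat.find_min hex hi, m0 - i, by
        rw [← Function.iterate_add_apply, Nat.sub_add_cancel (by omega), hm0]⟩
    refine hr.mono ?_
    rintro _ ⟨x, ⟨hxZ, hxv, hxB⟩, rfl⟩
    refine ⟨⟨S.ed_mem hxZ, fun h => hxv (hEC _ h x (by simp [Frst.ed]))⟩, fun h => ?_⟩
    have h1 := S.B_le hxB (hvZ N)
    rw [hvd] at h1
    have h2 : S.d x ≤ N := hN ⟨x, ⟨_, h, by simp [Frst.ed]⟩, rfl⟩
    omega
  obtain ⟨x, y, t, w, hx, hy, ht, htw, hw, hwE, hti, hdisj⟩ := ear_seq hG hEC htinf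
  refine finish_ray hG.1 T hvE hvG x y t w hx hy ht htw hw hwE hti hdisj ?_ (Or.inl inferInstance)
  intro u
  by_contra hu
  refine hc u fun F hF T0 hT0 => ?_
  have hb1 : (⋃ e ∈ F, {k | e ∈ (w k).edges}).Finite := hF.biUnion fun e _ =>
    Set.Subsingleton.finite fun k hk l hl => by
      by_contra hne
      exact hdisj k l hne e hk hl
  have hb2 : (t ⁻¹' T0).Finite := hT0.preimage hti.injOn
  obtain ⟨k, hk, hkb⟩ := Set.Infinite.exists_notMem_finite hu (hb1.union hb2)
  simp only [Set.mem_union, not_or] at hkb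
  have huC : u ∈ Set.range v := by
    rcases hk with rfl | rfl
    · exact hx k
    · exact hy k
  have hwF : ∀ e ∈ (w k).edges, e ∈ (G.edgeSet \ ∅) \ F := fun e he =>
    ⟨⟨(w k).edges_subset_edgeSet he, by simp⟩, fun h => hkb.1 (Set.mem_biUnion h he)⟩
  refine ⟨t k, (ht k).1, hkb.2, ?_, u, rfl, ?_⟩
  · intro h
    have h' : t k = u := h
    exact (ht k).2 (by rw [h']; exact huC)
  · rcases hk with rfl | rfl
    · exact (rch_of_walk ((w k).takeUntil _ (htw k)) fun e he =>
        hwF e ((w k).edges_takeUntil_subset_edges _ he)).symm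
    · exact rch_of_walk ((w k).dropUntil _ (htw k)) fun e he =>
        hwF e ((w k).edges_dropUntil_subset_edges _ he)

end TJ
/-- A 2-edge-connected graph contains a `T`-join for every infinite `T`. -/
theorem hasTJoin_of_twoEdgeConnected_of_infinite {V : Type*} (G : SimpleGraph V)
    (hG : G.TwoEdgeConnected) (T : Set V) (hT : T.Infinite) :
    G.HasTJoin T := by
  exact TJ.main hG hT
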